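/- arXiv:1905.06959 — 12 statements merged into one kernel-verified Lean document; each statement's English description precedes it below -/
import Mathlib

section
/- Let v, k, λ, s be positive integers with 1 < k < v − 1, k(k−1) = λ(v−1), s² = k − λ, and suppose that v divides at least one of k(k+s) and k(k−s). Then: (i) v divides exactly one of k(k+s) and k(k−s); (ii) gcd(k, v) > 1; (iii) gcd(s, v) > 1. In particular, v is composite. -/
/-- For symmetric design parameters, `(k - s)(k + s) = λ v`. -/
theorem sub_mul_add_eq_of_design {v k l s : ℤ} (hdesign : k * (k - 1) = l * (v - 1))
    (hs2 : s ^ 2 = k - l) : (k - s) * (k + s) = l * v := by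
  linear_combination hdesign - hs2

/-- The order satisfies `s < k`. -/
theorem order_lt_of_design {k l s : ℤ} (hl : 0 < l) (hs : 0 < s) (hs2 : s ^ 2 = k - l) :
    s < k := by
  nlinarith

theorem not_dvd_sub_of_design {v k l s : ℤ} (hl : 0 < l) (hs : 0 < s) (hk2 : k < v - 1)
    (hs2 : s ^ 2 = k - l) : ¬ v ∣ k - s := fun h => by
  have hsk := order_lt_of_design hl hs hs2
  have := Int.le_of_dvd (by linarith) h
  linarith

theorem not_dvd_add_of_design {v k l s : ℤ} (hl : 0 < l) (hs : 0 < s) (hk2 : k < v - 1)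
    (hdesign : k * (k - 1) = l * (v - 1)) (hs2 : s ^ 2 = k - l) : ¬ v ∣ k + s := by
  rintro ⟨c, hc⟩
  have hsk := order_lt_of_design hl hs hs2
  have hc0 : 0 < c := by nlinarith
  have hc2 : c < 2 := by nlinarith
  obtain rfl : c = 1 := by lia
  have hv0 : v ≠ 0 := by lia
  have hkl : k - s = l := mul_right_cancel₀ hv0 <| by
    linear_combination sub_mul_add_eq_of_design hdesign hs2 - (k - s) * hc
  have hs1 : s = 1 := mul_right_cancel₀ hs.ne' (by linear_combination hs2 + hkl)
  lia

theorem not_dvd_both_of_design {v k l s : ℤ} (hl : 0 < l) (hs : 0 < s) (hk1 : 1 < k)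
    (hk2 : k < v - 1) (hdesign : k * (k - 1) = l * (v - 1)) (hs2 : s ^ 2 = k - l) :
    ¬ (v ∣ k * (k + s) ∧ v ∣ k * (k - s)) := by
  rintro ⟨⟨a, ha⟩, ⟨b, hb⟩⟩
  have key := sub_mul_add_eq_of_design hdesign hs2
  have hsq : 2 * s ^ 2 = v * (a + b - 2 * l) := by linear_combination ha + hb - 2 * key
  have hc0 : 0 < a + b - 2 * l := by nlinarith
  have hc2 : a + b - 2 * l < 2 := by nlinarith
  have hv : v = 2 * s ^ 2 := by
    rw [hsq, show a + b - 2 * l = 1 by lia, mul_one]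
  have hk : k = s * (a - b) := mul_left_cancel₀ (mul_ne_zero two_ne_zero hs.ne') <| by
    linear_combination ha - hb + (a - b) * hv
  have hm : (a - b) ^ 2 - 1 = 2 * l := mul_left_cancel₀ (pow_ne_zero 2 hs.ne') <| by
    linear_combination key + l * hv - (k + s * (a - b)) * hk
  have hsum : (a - b - s) ^ 2 + s ^ 2 = 1 := by linear_combination hm + 2 * hs2 + 2 * hk
  have hs1 : s = 1 := by nlinarith [sq_nonneg (a - b - s)]
  subst hs1
  lia

/-- Integrality conditions for the parameters of a non-degenerate linked system of
symmetric designs: with `1 < k < v - 1`, `k(k-1) = λ(v-1)`, `s² = k - λ`, and `v`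
dividing at least one of `k(k+s)`, `k(k-s)`, we get: `v` divides exactly one of them,
`gcd(k,v) > 1`, `gcd(s,v) > 1`, and `v` is composite. -/
theorem stmt_0 (v k l s : ℤ) (hv : 0 < v) (hkpos : 0 < k) (hl : 0 < l) (hs : 0 < s)
    (hk1 : 1 < k) (hk2 : k < v - 1)
    (hdesign : k * (k - 1) = l * (v - 1))
    (hs2 : s ^ 2 = k - l)
    (hdiv : v ∣ k * (k + s) ∨ v ∣ k * (k - s)) :
    Xor' (v ∣ k * (k + s)) (v ∣ k * (k - s)) ∧
      1 < Int.gcd k v ∧ 1 < Int.gcd s v ∧ ¬ Prime v := by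
  have hadd := not_dvd_add_of_design hl hs hk2 hdesign hs2
  have hsub := not_dvd_sub_of_design hl hs hk2 hs2
  have key : v ∣ (k - s) * (k + s) :=
    ⟨l, by rw [sub_mul_add_eq_of_design hdesign hs2, mul_comm]⟩
  have gcd_gt : ∀ x : ℤ, 0 < x → (v ∣ x * (k + s) ∨ v ∣ x * (k - s)) → 1 < Int.gcd x v := by
    intro x hx h
    have hpos : 0 < Int.gcd x v := Int.gcd_pos_of_ne_zero_left v hx.ne'
    by_contra hle
    have hcop : IsCoprime v x := (Int.isCoprime_iff_gcd_eq_one.mpr (by lia)).symm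
    exact h.elim (fun h => hadd (hcop.dvd_of_dvd_mul_left h))
      fun h => hsub (hcop.dvd_of_dvd_mul_left h)
  have hgk := gcd_gt k hkpos hdiv
  refine ⟨xor_iff_or_and_not_and _ _ |>.mpr
    ⟨hdiv, not_dvd_both_of_design hl hs hk1 hk2 hdesign hs2⟩, hgk, gcd_gt s hs ?_, ?_⟩
  · refine hdiv.imp (fun h => ?_) fun h => ?_
    · rw [show s * (k + s) = k * (k + s) - (k - s) * (k + s) by ring]
      exact dvd_sub h key
    · rw [show s * (k - s) = (k - s) * (k + s) - k * (k - s) by ring]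
      exact dvd_sub key h
  · intro hp
    have hnd : ¬ v ∣ k := fun h => by
      have := Int.le_of_dvd hkpos h
      lia
    have := Int.isCoprime_iff_gcd_eq_one.mp (hp.coprime_iff_not_dvd.mpr hnd).symm
    lia
end

section
/- Let v, k, λ, s be positive integers with v ≥ 2, k(k−1) = λ(v−1), s² = k − λ, and v − 2k = −2s. Then v = 4s², k = 2s² + s, and λ = s² + s (Menon design parameters). Moreover, if s is odd then v does not divide k(k − s); consequently, the μ-heavy intersection number ν = k(k−s)/v is not an integer, so an optimistic linked system of symmetric designs with these parameters and more than two fibers cannot exist. -/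
/-- If `(v,k,λ)` are symmetric design parameters with `s² = k - λ` and `v - 2k = -2s`,
then they are Menon parameters `v = 4s², k = 2s² + s, λ = s² + s`; moreover if `s` is odd
then `v` does not divide `k(k-s)`. -/
theorem stmt_1 (v k l s : ℤ) (hv : 2 ≤ v) (hk : 0 < k) (hl : 0 < l) (hs : 0 < s)
    (hdesign : k * (k - 1) = l * (v - 1))
    (hs2 : s ^ 2 = k - l)
    (hopt : v - 2 * k = -(2 * s)) :
    v = 4 * s ^ 2 ∧ k = 2 * s ^ 2 + s ∧ l = s ^ 2 + s ∧
      (Odd s → ¬ v ∣ k * (k - s)) := by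
  have hks : k - s ≠ 0 := by intro h; linarith
  have hk' : k = 2 * s ^ 2 + s := by
    have hfactor : (k - s) * (k - s - 2 * s ^ 2) = 0 := by
      obtain rfl : v = 2 * k - 2 * s := by linarith
      obtain rfl : l = k - s ^ 2 := by linarith
      linear_combination -hdesign
    have := (mul_eq_zero.mp hfactor).resolve_left hks
    linarith
  have hv' : v = 4 * s ^ 2 := by linarith
  refine ⟨hv', hk', by linarith, ?_⟩
  rintro hodd ⟨c, hc⟩
  have hcancel : 2 * s ^ 2 * (2 * s ^ 2 + s) = 2 * s ^ 2 * (2 * c) := by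
    rw [hv', hk'] at hc
    linear_combination hc
  have hs_eq : 2 * s ^ 2 + s = 2 * c := mul_left_cancel₀ (by positivity) hcancel
  obtain ⟨m, hm⟩ := hodd
  omega
end

section
/- Let v ≥ 2, let {a_1,…,a_v} and {b_1,…,b_v} be two regular simplices in ℝ^{v−1}, and let γ ≠ δ be real numbers such that ⟨a_i, b_j⟩ ∈ {γ, δ} for all i, j (the simplices are linked with angles γ, δ). For each j put B_j = { i : ⟨a_i, b_j⟩ = γ }. Then for every j, |B_j| = vδ/(δ−γ), and for all s ≠ t, |B_s ∩ B_t| = vδ²/(γ−δ)² − v/((v−1)²(γ−δ)²). In particular, the points {a_i} together with the blocks {B_j} form a symmetric 2-design. -/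
open scoped RealInnerProductSpace Classical

section RegularSimplex

variable {ι E : Type*} [Fintype ι] [NormedAddCommGroup E] [InnerProductSpace ℝ E]
  {a : ι → E} {n : ℝ}

/-- Inner product of a vertex of a regular simplex with a linear combination of the vertices. -/
lemma simplex_inner_sum_smul (hn : n - 1 ≠ 0) (ha1 : ∀ i, ‖a i‖ = 1)
    (ha2 : ∀ i j, i ≠ j → ⟪a i, a j⟫ = -1 / (n - 1)) (c : ι → ℝ) (j : ι) :
    ⟪a j, ∑ i, c i • a i⟫ = n / (n - 1) * c j - (∑ i, c i) / (n - 1) := by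
  have gram : ∀ i, c i * ⟪a j, a i⟫ = (if j = i then n / (n - 1) * c i else 0) - c i / (n - 1) := by
    intro i
    split_ifs with h
    · subst h
      rw [real_inner_self_eq_norm_sq, ha1]
      field_simp
    · rw [ha2 j i h]
      ring
  simp only [inner_sum, inner_smul_right, gram, Finset.sum_sub_distrib, Finset.sum_ite_eq,
    Finset.mem_univ, if_true, Finset.sum_div]

/-- The vertices of a regular simplex sum to zero. -/
lemma simplex_sum_eq_zero (hcard : (Fintype.card ι : ℝ) = n) (hn : n - 1 ≠ 0)
    (ha1 : ∀ i, ‖a i‖ = 1) (ha2 : ∀ i j, i ≠ j → ⟪a i, a j⟫ = -1 / (n - 1)) :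
    ∑ i, a i = 0 := by
  have orth : ∀ j, ⟪a j, ∑ i, a i⟫ = 0 := by
    intro j
    have h := simplex_inner_sum_smul hn ha1 ha2 (fun _ => 1) j
    simp only [one_smul, Finset.sum_const, Finset.card_univ, nsmul_eq_mul, hcard] at h
    rw [h]
    ring
  rw [← inner_self_eq_zero (𝕜 := ℝ), sum_inner]
  exact Finset.sum_eq_zero fun j _ => orth j

/-- The vertices of a regular simplex span any space of dimension less than their number. -/
lemma simplex_linearCombination_surjective [FiniteDimensional ℝ E]
    (hdim : Module.finrank ℝ E + 1 ≤ Fintype.card ι) (hn0 : n ≠ 0) (hn : n - 1 ≠ 0)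
    (ha1 : ∀ i, ‖a i‖ = 1) (ha2 : ∀ i j, i ≠ j → ⟪a i, a j⟫ = -1 / (n - 1)) (x : E) :
    ∃ c : ι → ℝ, ∑ i, c i • a i = x := by
  have hker : LinearMap.ker (Fintype.linearCombination ℝ a) ≤ ℝ ∙ (fun _ : ι => (1 : ℝ)) := by
    intro c hc
    rw [LinearMap.mem_ker, Fintype.linearCombination_apply] at hc
    refine Submodule.mem_span_singleton.2 ⟨(∑ i, c i) / n, funext fun j => ?_⟩
    have h := simplex_inner_sum_smul hn ha1 ha2 c j
    rw [hc, inner_zero_right] at h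
    field_simp at h
    simp only [Pi.smul_apply, smul_eq_mul, mul_one]
    rw [div_eq_iff hn0]
    linarith
  have hle := (Submodule.finrank_mono hker).trans (finrank_span_le_card (R := ℝ) {fun _ : ι => (1 : ℝ)})
  rw [Set.toFinset_singleton, Finset.card_singleton] at hle
  have hrank := (Fintype.linearCombination ℝ a).finrank_range_add_finrank_ker
  rw [Module.finrank_fintype_fun_eq_card] at hrank
  have htop : LinearMap.range (Fintype.linearCombination ℝ a) = ⊤ := by
    apply Submodule.eq_top_of_finrank_eq
    have := Submodule.finrank_le (LinearMap.range (Fintype.linearCombination ℝ a))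
    omega
  exact LinearMap.range_eq_top.1 htop x

/-- The vertices of a regular simplex form a tight frame. -/
lemma simplex_sum_inner_mul_inner [FiniteDimensional ℝ E]
    (hdim : Module.finrank ℝ E + 1 ≤ Fintype.card ι) (hcard : (Fintype.card ι : ℝ) = n)
    (hn0 : n ≠ 0) (hn : n - 1 ≠ 0) (ha1 : ∀ i, ‖a i‖ = 1)
    (ha2 : ∀ i j, i ≠ j → ⟪a i, a j⟫ = -1 / (n - 1)) (x y : E) :
    ∑ i, ⟪a i, x⟫ * ⟪a i, y⟫ = n / (n - 1) * ⟪x, y⟫ := by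
  obtain ⟨c, rfl⟩ := simplex_linearCombination_surjective hdim hn0 hn ha1 ha2 x
  have hzero : ∑ i, ⟪a i, y⟫ = 0 := by
    rw [← sum_inner, simplex_sum_eq_zero hcard hn ha1 ha2, inner_zero_left]
  simp only [simplex_inner_sum_smul hn ha1 ha2, sub_mul, Finset.sum_sub_distrib, mul_assoc,
    ← Finset.mul_sum, hzero, mul_zero, sub_zero, sum_inner, real_inner_smul_left]

end RegularSimplex

section TwoValued

variable {ι : Type*} [Fintype ι] {γ δ : ℝ} {f g : ι → ℝ}

/-- The sum of a function with two values. -/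
lemma sum_eq_of_two_valued (hf : ∀ i, f i = γ ∨ f i = δ) :
    ∑ i, f i = Fintype.card ι * δ + (γ - δ) * (Finset.univ.filter fun i => f i = γ).card := by
  have h : ∀ i, f i = δ + (γ - δ) * if f i = γ then 1 else 0 := by
    intro i
    rcases hf i with h | h <;> split_ifs <;> linarith
  rw [Finset.sum_congr rfl fun i _ => h i, Finset.sum_add_distrib, ← Finset.mul_sum,
    Finset.sum_boole]
  simp

/-- The sum of the products of two functions with the same two values. -/
lemma sum_mul_eq_of_two_valued [DecidableEq ι] (hf : ∀ i, f i = γ ∨ f i = δ)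
    (hg : ∀ i, g i = γ ∨ g i = δ) :
    ∑ i, f i * g i = δ * ∑ i, f i + δ * ∑ i, g i - Fintype.card ι * δ ^ 2 + (γ - δ) ^ 2 *
      ((Finset.univ.filter fun i => f i = γ) ∩ (Finset.univ.filter fun i => g i = γ)).card := by
  have h : ∀ i, f i * g i = δ * f i + δ * g i - δ ^ 2 +
      (γ - δ) ^ 2 * if f i = γ ∧ g i = γ then 1 else 0 := by
    intro i
    split_ifs with h
    · rw [h.1, h.2]
      ring
    · rcases hf i with hi | hi
      · rw [(hg i).resolve_left fun hi' => h ⟨hi, hi'⟩]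
        ring
      · rw [hi]
        ring
  rw [Finset.sum_congr rfl fun i _ => h i, ← Finset.filter_and, Finset.sum_add_distrib,
    Finset.sum_sub_distrib, Finset.sum_add_distrib, ← Finset.mul_sum, ← Finset.mul_sum,
    ← Finset.mul_sum, Finset.sum_boole]
  simp

end TwoValued

/-- Two linked regular simplices in ℝ^{v-1} with angles γ ≠ δ yield a symmetric 2-design:
each block `B_j = {i : ⟨a_i,b_j⟩ = γ}` has size `vδ/(δ-γ)` and distinct blocks intersect in
`vδ²/(γ-δ)² - v/((v-1)²(γ-δ)²)` points. -/
theorem stmt_3 (v : ℕ) (hv : 2 ≤ v) (γ δ : ℝ) (hγδ : γ ≠ δ)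
    (a b : Fin v → EuclideanSpace ℝ (Fin (v - 1)))
    (ha1 : ∀ i, ‖a i‖ = 1)
    (ha2 : ∀ i j, i ≠ j → ⟪a i, a j⟫ = -1 / ((v : ℝ) - 1))
    (hb1 : ∀ i, ‖b i‖ = 1)
    (hb2 : ∀ i j, i ≠ j → ⟪b i, b j⟫ = -1 / ((v : ℝ) - 1))
    (hlink : ∀ i j, ⟪a i, b j⟫ = γ ∨ ⟪a i, b j⟫ = δ) :
    (∀ j, ((Finset.univ.filter fun i => ⟪a i, b j⟫ = γ).card : ℝ)
        = (v : ℝ) * δ / (δ - γ)) ∧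
    (∀ s t, s ≠ t →
      (((Finset.univ.filter fun i => ⟪a i, b s⟫ = γ) ∩
          (Finset.univ.filter fun i => ⟪a i, b t⟫ = γ)).card : ℝ)
        = (v : ℝ) * δ ^ 2 / (γ - δ) ^ 2
            - (v : ℝ) / (((v : ℝ) - 1) ^ 2 * (γ - δ) ^ 2)) := by
  have hv' : (2 : ℝ) ≤ v := by exact_mod_cast hv
  have hn0 : (v : ℝ) ≠ 0 := by linarith
  have hn : (v : ℝ) - 1 ≠ 0 := by linarith
  have hcard : (Fintype.card (Fin v) : ℝ) = v := by simp
  have hdim : Module.finrank ℝ (EuclideanSpace ℝ (Fin (v - 1))) + 1 ≤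
      Fintype.card (Fin v) := by
    rw [finrank_euclideanSpace_fin, Fintype.card_fin]
    omega
  have hsum : ∀ j, ∑ i, ⟪a i, b j⟫ = 0 := fun j => by
    rw [← sum_inner, simplex_sum_eq_zero hcard hn ha1 ha2, inner_zero_left]
  refine ⟨fun j => ?_, fun s t hst => ?_⟩
  · have h := sum_eq_of_two_valued fun i => hlink i j
    rw [hsum, hcard] at h
    rw [eq_div_iff (sub_ne_zero.2 hγδ.symm)]
    linarith
  · have h := sum_mul_eq_of_two_valued (fun i => hlink i s) (fun i => hlink i t)
    rw [hsum, hsum, hcard, simplex_sum_inner_mul_inner hdim hcard hn0 hn ha1 ha2,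
      hb2 s t hst] at h
    have hd : (γ - δ) ^ 2 ≠ 0 := pow_ne_zero 2 (sub_ne_zero.2 hγδ)
    rw [← div_div, ← sub_div, eq_div_iff hd]
    have hfrac : (v : ℝ) / (v - 1) * (-1 / (v - 1)) = -(v / (v - 1) ^ 2) := by
      field_simp
    linarith
end

section
/- Let v ≥ 2 and let {a_i}, {b_i}, {c_i} be three regular simplices in ℝ^{v−1} that are pairwise linked with the same angles γ ≠ δ (every inner product between vectors of distinct simplices lies in {γ, δ}). For 1 ≤ j, k ≤ v set B_j = { i : ⟨a_i, b_j⟩ = γ } and C_k = { i : ⟨a_i, c_k⟩ = γ }. Then |B_j ∩ C_k| = v(δ²(v−1) + δ)/((γ−δ)²(v−1)) whenever ⟨b_j, c_k⟩ = δ, and |B_j ∩ C_k| = v(δ²(v−1) + δ)/((γ−δ)²(v−1)) + v/((γ−δ)(v−1)) whenever ⟨b_j, c_k⟩ = γ. In particular |B_j ∩ C_k| takes only two values μ and ν, depending only on the inner product ⟨b_j, c_k⟩. -/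
open scoped RealInnerProductSpace Classical

section RegularSimplex

variable {ι E : Type*} [Fintype ι] [DecidableEq ι] [NormedAddCommGroup E] [InnerProductSpace ℝ E]
  {a : ι → E} {r s : ℝ}

/-- The vectors of a regular simplex sum to zero. -/
lemma sum_eq_zero_of_inner_eq
    (h : ∀ i j, ⟪a i, a j⟫ = (if i = j then r else 0) - s)
    (hrs : r = Fintype.card ι * s) : ∑ i, a i = 0 := by
  rw [← inner_self_eq_zero (𝕜 := ℝ), sum_inner]
  refine Finset.sum_eq_zero fun i _ => ?_
  simp [inner_sum, h, Finset.sum_sub_distrib, hrs]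

/-- Removing one vertex from a regular simplex leaves a linearly independent family. -/
lemma linearIndependent_ne_of_inner_eq
    (h : ∀ i j, ⟪a i, a j⟫ = (if i = j then r else 0) - s)
    (hr : r ≠ 0) (i₀ : ι) :
    LinearIndependent ℝ (fun i : {i // i ≠ i₀} => a i) := by
  rw [Fintype.linearIndependent_iff]
  intro g hg j
  have key (k : ι) : ∑ i : {i // i ≠ i₀}, g i * ((if k = i then r else 0) - s) = 0 := by
    have := congrArg (fun x => ⟪a k, x⟫) hg
    simpa only [inner_sum, inner_smul_right, h, inner_zero_right] using this
  have h0 := key i₀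
  have hj := key j
  have hne (i : {i // i ≠ i₀}) : i₀ ≠ i := fun e => i.2 e.symm
  simp only [hne, if_false, mul_sub, Finset.sum_sub_distrib, mul_zero,
    Finset.sum_const_zero] at h0
  simp only [mul_sub, Finset.sum_sub_distrib, ← Subtype.ext_iff, mul_ite, mul_zero,
    Finset.sum_ite_eq, Finset.mem_univ, if_true] at hj
  have : g j * r = 0 := by linarith
  exact (mul_eq_zero.mp this).resolve_right hr

/-- A regular simplex of full dimension is a tight frame. -/
lemma sum_inner_mul_inner_of_inner_eq [FiniteDimensional ℝ E]
    (h : ∀ i j, ⟪a i, a j⟫ = (if i = j then r else 0) - s)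
    (hrs : r = Fintype.card ι * s) (hr : r ≠ 0)
    (hdim : Fintype.card ι = Module.finrank ℝ E + 1) (x y : E) :
    ∑ i, ⟪a i, x⟫ * ⟪a i, y⟫ = r * ⟪x, y⟫ := by
  have hsum := sum_eq_zero_of_inner_eq h hrs
  obtain ⟨i₀⟩ : Nonempty ι := Fintype.card_pos_iff.mp (by omega)
  have hspan := (linearIndependent_ne_of_inner_eq h hr i₀).span_eq_top_of_card_eq_finrank'
    (by simp [Fintype.card_subtype_compl, hdim])
  have hx : x ∈ Submodule.span ℝ (Set.range fun i : {i // i ≠ i₀} => a i) := by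
    rw [hspan]; trivial
  induction hx using Submodule.span_induction with
  | mem x hx =>
    obtain ⟨j, rfl⟩ := hx
    simp only [h, sub_mul, ite_mul, zero_mul, Finset.sum_sub_distrib, ← Finset.mul_sum,
      ← sum_inner, hsum, inner_zero_left, mul_zero, sub_zero, Finset.sum_ite_eq',
      Finset.mem_univ, if_true]
  | zero => simp
  | add x z _ _ hx hz => simp only [inner_add_left, inner_add_right, add_mul,
      Finset.sum_add_distrib, hx, hz, mul_add]
  | smul t x _ hx =>
    simp only [inner_smul_left, inner_smul_right, mul_assoc, ← Finset.mul_sum, hx]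
    simp only [conj_trivial]
    ring

end RegularSimplex

/-- Counting the common `γ`-positions of two `{γ, δ}`-valued functions. -/
lemma card_filter_inter_mul_sq {ι : Type*} [Fintype ι] [DecidableEq ι] {f g : ι → ℝ} {γ δ : ℝ}
    (hf : ∀ i, f i = γ ∨ f i = δ) (hg : ∀ i, g i = γ ∨ g i = δ) (hγδ : γ ≠ δ) :
    (((Finset.univ.filter fun i => f i = γ) ∩
      (Finset.univ.filter fun i => g i = γ)).card : ℝ) * (γ - δ) ^ 2 =
      ∑ i, (f i - δ) * (g i - δ) := by
  rw [← Finset.filter_and, ← nsmul_eq_mul, ← Finset.sum_const, Finset.sum_filter]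
  refine Finset.sum_congr rfl fun i _ => ?_
  rcases hf i with h | h <;> rcases hg i with h' | h' <;> simp [h, h', hγδ.symm, sq]

/-- Three pairwise linked regular simplices in ℝ^{v-1} with angles γ ≠ δ: the size of
`B_j ∩ C_k` depends only on the inner product `⟨b_j, c_k⟩`, taking the two displayed values. -/
theorem stmt_4 (v : ℕ) (hv : 2 ≤ v) (γ δ : ℝ) (hγδ : γ ≠ δ)
    (a b c : Fin v → EuclideanSpace ℝ (Fin (v - 1)))
    (ha1 : ∀ i, ‖a i‖ = 1)
    (ha2 : ∀ i j, i ≠ j → ⟪a i, a j⟫ = -1 / ((v : ℝ) - 1))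
    (hb1 : ∀ i, ‖b i‖ = 1)
    (hb2 : ∀ i j, i ≠ j → ⟪b i, b j⟫ = -1 / ((v : ℝ) - 1))
    (hc1 : ∀ i, ‖c i‖ = 1)
    (hc2 : ∀ i j, i ≠ j → ⟪c i, c j⟫ = -1 / ((v : ℝ) - 1))
    (hab : ∀ i j, ⟪a i, b j⟫ = γ ∨ ⟪a i, b j⟫ = δ)
    (hac : ∀ i j, ⟪a i, c j⟫ = γ ∨ ⟪a i, c j⟫ = δ)
    (hbc : ∀ i j, ⟪b i, c j⟫ = γ ∨ ⟪b i, c j⟫ = δ) :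
    ∀ j k : Fin v,
      (⟪b j, c k⟫ = δ →
        ((((Finset.univ.filter fun i => ⟪a i, b j⟫ = γ) ∩
            (Finset.univ.filter fun i => ⟪a i, c k⟫ = γ)).card : ℝ)
          = (v : ℝ) * (δ ^ 2 * ((v : ℝ) - 1) + δ) / ((γ - δ) ^ 2 * ((v : ℝ) - 1)))) ∧
      (⟪b j, c k⟫ = γ →
        ((((Finset.univ.filter fun i => ⟪a i, b j⟫ = γ) ∩
            (Finset.univ.filter fun i => ⟪a i, c k⟫ = γ)).card : ℝ)
          = (v : ℝ) * (δ ^ 2 * ((v : ℝ) - 1) + δ) / ((γ - δ) ^ 2 * ((v : ℝ) - 1))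
              + (v : ℝ) / ((γ - δ) * ((v : ℝ) - 1)))) := by
  intro j k
  have hv' : (0 : ℝ) < (v : ℝ) - 1 := by
    have : (2 : ℝ) ≤ v := by exact_mod_cast hv
    linarith
  have hd : γ - δ ≠ 0 := sub_ne_zero.mpr hγδ
  have hgram : ∀ i j, ⟪a i, a j⟫ =
      (if i = j then (v : ℝ) / ((v : ℝ) - 1) else 0) - 1 / ((v : ℝ) - 1) := by
    intro i j
    split_ifs with hij
    · subst hij
      rw [real_inner_self_eq_norm_sq, ha1]
      field_simp
    · rw [ha2 i j hij]
      ring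
  have hrs : (v : ℝ) / ((v : ℝ) - 1) = Fintype.card (Fin v) * (1 / ((v : ℝ) - 1)) := by
    rw [Fintype.card_fin]
    ring
  have hr : (v : ℝ) / ((v : ℝ) - 1) ≠ 0 := div_ne_zero (by linarith) hv'.ne'
  have hsum := sum_eq_zero_of_inner_eq hgram hrs
  have hframe := sum_inner_mul_inner_of_inner_eq hgram hrs hr
    (by simp only [Fintype.card_fin, finrank_euclideanSpace]; omega) (b j) (c k)
  have hzero (x : EuclideanSpace ℝ (Fin (v - 1))) : ∑ i, ⟪a i, x⟫ = 0 := by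
    rw [← sum_inner, hsum, inner_zero_left]
  have hcard := card_filter_inter_mul_sq (fun i => hab i j) (fun i => hac i k) hγδ
  have hexpand : ∑ i, (⟪a i, b j⟫ - δ) * (⟪a i, c k⟫ - δ) =
      (v : ℝ) / ((v : ℝ) - 1) * ⟪b j, c k⟫ + v * δ ^ 2 := by
    simp only [sub_mul, mul_sub, Finset.sum_sub_distrib, ← Finset.mul_sum, ← Finset.sum_mul,
      hframe, hzero, Finset.sum_const, Finset.card_univ, Fintype.card_fin, nsmul_eq_mul]
    ring
  rw [hexpand, ← eq_div_iff (pow_ne_zero 2 hd)] at hcard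
  constructor <;> intro ht <;> rw [hcard, ht] <;> field_simp <;> ring
end

section
/- Let Γ be a linked system of symmetric designs LSSD(v,k,λ;w) with 1 < k < v − 1 which is μ-heavy (μ > ν; this condition is vacuous when w = 2), and set s = √(k−λ). Then there exist unit vectors (x_a), one for each vertex a of Γ, in ℝ^{v−1} such that for all distinct vertices a, b: ⟨x_a, x_b⟩ = −1/(v−1) if a and b lie in the same fiber; ⟨x_a, x_b⟩ = (v−k)/((v−1)s) if a and b are adjacent in Γ; and ⟨x_a, x_b⟩ = −k/((v−1)s) if a and b lie in distinct fibers and are not adjacent. In particular, the w fibers of Γ yield a set of w linked simplices in ℝ^{v−1}. -/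
open scoped RealInnerProductSpace

/-- A (homogeneous) linked system of symmetric designs `LSSD(v,k,λ;w)`: a graph on
`w` fibers of size `v` with no edges inside fibers, inducing a symmetric `(v,k,λ)`-design
between any two fibers, and with well-defined triple intersection numbers `μ` (adjacent
pairs) and `ν` (non-adjacent pairs in distinct fibers). -/
def IsLSSD (v k lam : ℕ) {w : ℕ} (Γ : SimpleGraph (Fin w × Fin v)) (μ ν : ℕ) : Prop :=
  (∀ a b : Fin w × Fin v, Γ.Adj a b → a.1 ≠ b.1) ∧
  (∀ (a : Fin w × Fin v) (j : Fin w), j ≠ a.1 →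
      {y : Fin v | Γ.Adj a (j, y)}.ncard = k) ∧
  (∀ (i : Fin w) (x y : Fin v), x ≠ y → ∀ j : Fin w, j ≠ i →
      {z : Fin v | Γ.Adj (i, x) (j, z) ∧ Γ.Adj (i, y) (j, z)}.ncard = lam) ∧
  (∀ h i j : Fin w, h ≠ i → h ≠ j → i ≠ j → ∀ x y : Fin v,
      (Γ.Adj (i, x) (j, y) →
          {z : Fin v | Γ.Adj (i, x) (h, z) ∧ Γ.Adj (j, y) (h, z)}.ncard = μ) ∧
      (¬ Γ.Adj (i, x) (j, y) →
          {z : Fin v | Γ.Adj (i, x) (h, z) ∧ Γ.Adj (j, y) (h, z)}.ncard = ν))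

open Classical in
/-- The centred adjacency function `A - (k / v) J` of a graph on `Fin w × Fin v`. -/
noncomputable def centredAdj {v w : ℕ} (k : ℕ) (Γ : SimpleGraph (Fin w × Fin v))
    (a b : Fin w × Fin v) : ℝ :=
  Γ.adjMatrix ℝ a b - (k : ℝ) / v

/-- Vectors of `ℝ^v` with zero coordinate sum embed isometrically into `ℝ^(v-1)`. -/
theorem exists_inner_eq_of_sum_eq_zero {α : Type*} {v : ℕ} (hv : 0 < v)
    (u : α → EuclideanSpace ℝ (Fin v)) (hu : ∀ a, ∑ z, u a z = 0) :
    ∃ x : α → EuclideanSpace ℝ (Fin (v - 1)), ∀ a b, ⟪x a, x b⟫ = ⟪u a, u b⟫ := by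
  set e : EuclideanSpace ℝ (Fin v) := WithLp.toLp 2 (fun _ => (1 : ℝ)) with he
  have hne : e ≠ 0 := fun h => by
    have := congrArg (fun t : EuclideanSpace ℝ (Fin v) => t ⟨0, hv⟩) h
    simp [he] at this
  have : Fact (Module.finrank ℝ (EuclideanSpace ℝ (Fin v)) = (v - 1) + 1) :=
    ⟨by rw [finrank_euclideanSpace_fin]; omega⟩
  have hmem : ∀ a, u a ∈ (Submodule.span ℝ {e})ᗮ := fun a => by
    rw [Submodule.mem_orthogonal_singleton_iff_inner_right]
    simp [PiLp.inner_apply, he, hu a]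
  refine ⟨fun a => (OrthonormalBasis.fromOrthogonalSpanSingleton (𝕜 := ℝ) (v - 1) hne).repr
    ⟨u a, hmem a⟩, fun a b => ?_⟩
  rw [LinearIsometryEquiv.inner_map_map, Submodule.coe_inner]

namespace IsLSSD

variable {v k lam w μ ν : ℕ} {Γ : SimpleGraph (Fin w × Fin v)}

theorem centredAdj_comm (a b : Fin w × Fin v) : centredAdj k Γ a b = centredAdj k Γ b a := by
  simp only [centredAdj, SimpleGraph.adjMatrix_apply]
  rw [Γ.adj_comm a b]

open Classical in
theorem sum_adj (hΓ : IsLSSD v k lam Γ μ ν) {a : Fin w × Fin v} {j : Fin w} (hj : j ≠ a.1) :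
    ∑ z, Γ.adjMatrix ℝ a (j, z) = k := by
  rw [← hΓ.2.1 a j hj, Set.ncard_eq_toFinset_card']
  simp [SimpleGraph.adjMatrix_apply]

open Classical in
theorem sum_adj_mul_adj (a b : Fin w × Fin v) (j : Fin w) :
    ∑ z, Γ.adjMatrix ℝ a (j, z) * Γ.adjMatrix ℝ b (j, z) =
      ({z : Fin v | Γ.Adj a (j, z) ∧ Γ.Adj b (j, z)}.ncard : ℝ) := by
  rw [Set.ncard_eq_toFinset_card']
  simp only [SimpleGraph.adjMatrix_apply, ite_zero_mul_ite_zero, mul_one, Finset.sum_boole,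
    Set.toFinset_ofPred]

open Classical in
/-- Counting paths from `a` through fiber `h` to fiber `j`. -/
theorem sum_sum_adj_mul_adj (hΓ : IsLSSD v k lam Γ μ ν) {a : Fin w × Fin v} {h j : Fin w}
    (ha : h ≠ a.1) (hj : h ≠ j) :
    ∑ y, ∑ z, Γ.adjMatrix ℝ a (h, z) * Γ.adjMatrix ℝ (j, y) (h, z) = (k : ℝ) * k := by
  rw [Finset.sum_comm]
  have hcol : ∀ z, ∑ y, Γ.adjMatrix ℝ (j, y) (h, z) = k := fun z => by
    rw [← hΓ.sum_adj (a := (h, z)) (j := j) hj.symm]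
    exact Finset.sum_congr rfl fun y _ => by simp [SimpleGraph.adjMatrix_apply, Γ.adj_comm]
  simp_rw [← Finset.mul_sum, hcol, ← Finset.sum_mul]
  rw [hΓ.sum_adj ha]

theorem sum_centredAdj (hΓ : IsLSSD v k lam Γ μ ν) (hv : 0 < v) {a : Fin w × Fin v} {j : Fin w}
    (hj : j ≠ a.1) : ∑ z, centredAdj k Γ a (j, z) = 0 := by
  have hv' : (v : ℝ) ≠ 0 := by positivity
  simp only [centredAdj, Finset.sum_sub_distrib, hΓ.sum_adj hj]
  simp
  field_simp
  ring

theorem sum_centredAdj_mul (hΓ : IsLSSD v k lam Γ μ ν) (hv : 0 < v) {a b : Fin w × Fin v}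
    {h : Fin w} (ha : h ≠ a.1) (hb : h ≠ b.1) :
    ∑ z, centredAdj k Γ a (h, z) * centredAdj k Γ b (h, z) =
      ({z : Fin v | Γ.Adj a (h, z) ∧ Γ.Adj b (h, z)}.ncard : ℝ) - (k : ℝ) ^ 2 / v := by
  classical
  have hv' : (v : ℝ) ≠ 0 := by positivity
  rw [← sum_adj_mul_adj]
  have : ∀ z, centredAdj k Γ a (h, z) * centredAdj k Γ b (h, z) =
      Γ.adjMatrix ℝ a (h, z) * Γ.adjMatrix ℝ b (h, z)
      - (k : ℝ) / v * Γ.adjMatrix ℝ a (h, z) - (k : ℝ) / v * Γ.adjMatrix ℝ b (h, z)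
      + ((k : ℝ) / v) ^ 2 := fun z => by
    simp only [centredAdj]; ring
  simp_rw [this, Finset.sum_add_distrib, Finset.sum_sub_distrib, ← Finset.mul_sum,
    hΓ.sum_adj ha, hΓ.sum_adj hb]
  simp
  field_simp
  ring

/-- The two-fiber count `λ (v - 1) = k (k - 1)`. -/
theorem lam_mul (hΓ : IsLSSD v k lam Γ μ ν) (hv : 0 < v) (hw : 2 ≤ w) :
    (lam : ℝ) * (v - 1) = k * (k - 1) := by
  classical
  let i : Fin w := ⟨0, by omega⟩
  let j : Fin w := ⟨1, by omega⟩
  have hji : j ≠ i := by simp [i, j]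
  let x : Fin v := ⟨0, hv⟩
  have key := hΓ.sum_sum_adj_mul_adj (a := (i, x)) (h := j) (j := i) hji hji
  have hrow : ∀ y, ∑ z, Γ.adjMatrix ℝ (i, x) (j, z) * Γ.adjMatrix ℝ (i, y) (j, z) =
      lam + if x = y then (k : ℝ) - lam else 0 := fun y => by
    rw [sum_adj_mul_adj]
    split_ifs with hxy
    · subst hxy
      simp only [and_self, hΓ.2.1 (i, x) j hji]
      ring
    · rw [hΓ.2.2.1 i x y hxy j hji, add_zero]
  simp_rw [hrow, Finset.sum_add_distrib] at key
  simp at key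
  linarith

theorem sum_centredAdj_mul_same (hΓ : IsLSSD v k lam Γ μ ν) (hv : 0 < v) (hw : 2 ≤ w)
    {i h : Fin w} (hi : h ≠ i) (x y : Fin v) :
    ∑ z, centredAdj k Γ (i, x) (h, z) * centredAdj k Γ (i, y) (h, z) =
      ((k : ℝ) - lam) * ((if x = y then 1 else 0) - 1 / v) := by
  have hv' : (v : ℝ) ≠ 0 := by positivity
  have hl := hΓ.lam_mul hv hw
  rw [hΓ.sum_centredAdj_mul hv hi hi]
  split_ifs with hxy
  · subst hxy
    simp only [and_self, hΓ.2.1 (i, x) h hi]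
    field_simp
    linarith
  · rw [hΓ.2.2.1 i x y hxy h hi]
    field_simp
    linarith

theorem sum_centredAdj_mul_distinct (hΓ : IsLSSD v k lam Γ μ ν) (hv : 0 < v)
    {h i j : Fin w} (hi : h ≠ i) (hj : h ≠ j) (hij : i ≠ j) (x y : Fin v) :
    ∑ z, centredAdj k Γ (i, x) (h, z) * centredAdj k Γ (j, y) (h, z) =
      ((μ : ℝ) - ν) * centredAdj k Γ (i, x) (j, y) := by
  classical
  have hv' : (v : ℝ) ≠ 0 := by positivity
  have hcount : ∀ y, ({z : Fin v | Γ.Adj (i, x) (h, z) ∧ Γ.Adj (j, y) (h, z)}.ncard : ℝ) =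
      ν + ((μ : ℝ) - ν) * Γ.adjMatrix ℝ (i, x) (j, y) := fun y => by
    by_cases hA : Γ.Adj (i, x) (j, y)
    · rw [(hΓ.2.2.2 h i j hi hj hij x y).1 hA]
      simp [SimpleGraph.adjMatrix_apply, hA]
    · rw [(hΓ.2.2.2 h i j hi hj hij x y).2 hA]
      simp [SimpleGraph.adjMatrix_apply, hA]
  have key := hΓ.sum_sum_adj_mul_adj (a := (i, x)) (h := h) (j := j) hi hj
  simp_rw [sum_adj_mul_adj, hcount, Finset.sum_add_distrib, ← Finset.mul_sum] at key
  rw [hΓ.sum_adj (a := (i, x)) hij.symm] at key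
  simp at key
  rw [hΓ.sum_centredAdj_mul hv hi hj, hcount]
  simp only [centredAdj]
  field_simp
  linear_combination key

/-- In a linked system on at least three fibers, `(μ - ν)² = k - λ`. -/
theorem sub_sq (hΓ : IsLSSD v k lam Γ μ ν) (hv : 1 < v) (hw : 2 ≤ w) (hs : (0 : ℝ) < k - lam)
    {h i j : Fin w} (hi : h ≠ i) (hj : h ≠ j) (hij : i ≠ j) :
    ((μ : ℝ) - ν) ^ 2 = k - lam := by
  have hv0 : 0 < v := by omega
  let x : Fin v := ⟨0, hv0⟩
  let f : Fin v → ℝ := fun z => centredAdj k Γ (i, x) (h, z)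
  have hff : ∑ z, f z * f z = ((k : ℝ) - lam) * (1 - 1 / v) := by
    simpa using hΓ.sum_centredAdj_mul_same hv0 hw hi x x
  have hf : ∑ z, f z = 0 := hΓ.sum_centredAdj hv0 (a := (i, x)) hi
  have hcol : ∀ z z', ∑ y, centredAdj k Γ (j, y) (h, z) * centredAdj k Γ (j, y) (h, z') =
      ((k : ℝ) - lam) * ((if z = z' then 1 else 0) - 1 / v) := fun z z' => by
    rw [← hΓ.sum_centredAdj_mul_same hv0 hw (i := h) (h := j) hj.symm z z']
    exact Finset.sum_congr rfl fun y _ => by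
      rw [centredAdj_comm (j, y) (h, z), centredAdj_comm (j, y) (h, z')]
  have hleft : ∑ y, (∑ z, f z * centredAdj k Γ (j, y) (h, z)) ^ 2 =
      ((k : ℝ) - lam) * (((k : ℝ) - lam) * (1 - 1 / v)) := by
    calc _ = ∑ z, ∑ z', f z * f z' *
          ∑ y, centredAdj k Γ (j, y) (h, z) * centredAdj k Γ (j, y) (h, z') := by
          simp_rw [sq, Finset.sum_mul_sum, Finset.mul_sum]
          rw [Finset.sum_comm]
          refine Finset.sum_congr rfl fun z _ => ?_
          rw [Finset.sum_comm]
          exact Finset.sum_congr rfl fun z' _ => Finset.sum_congr rfl fun y _ => by ring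
      _ = ∑ z, (((k : ℝ) - lam) * (f z * f z) - ((k : ℝ) - lam) / v * f z * ∑ z', f z') := by
          refine Finset.sum_congr rfl fun z _ => ?_
          have : ∀ z', f z * f z' * (((k : ℝ) - lam) * ((if z = z' then 1 else 0) - 1 / v)) =
              (if z = z' then ((k : ℝ) - lam) * (f z * f z') else 0)
                - ((k : ℝ) - lam) / v * f z * f z' := fun z' => by
            split_ifs <;> ring
          simp_rw [hcol, this, Finset.sum_sub_distrib, ← Finset.mul_sum]
          simp
      _ = _ := by simp only [hf, mul_zero, sub_zero, ← Finset.mul_sum, hff]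
  have hright : ∑ y, (∑ z, f z * centredAdj k Γ (j, y) (h, z)) ^ 2 =
      ((μ : ℝ) - ν) ^ 2 * (((k : ℝ) - lam) * (1 - 1 / v)) := by
    have hnorm := hΓ.sum_centredAdj_mul_same hv0 hw (i := i) (h := j) hij.symm x x
    simp only [if_true] at hnorm
    rw [← hnorm, Finset.mul_sum]
    refine Finset.sum_congr rfl fun y _ => ?_
    rw [hΓ.sum_centredAdj_mul_distinct hv0 hi hj hij x y]
    ring
  have hpos : (0 : ℝ) < ((k : ℝ) - lam) * (1 - 1 / v) := by
    have : (1 : ℝ) / v < 1 := by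
      rw [div_lt_one (by positivity)]
      exact_mod_cast hv
    exact mul_pos hs (by linarith)
  exact mul_right_cancel₀ hpos.ne' (hright.symm.trans hleft)

/-- The Gram matrix of the fibers, up to scaling by `v / (v - 1)`, is realised by vectors of
`ℝ^v` with zero coordinate sum. -/
theorem exists_gram (hΓ : IsLSSD v k lam Γ μ ν) (hv : 1 < v) (hw : 2 ≤ w)
    (hs : (0 : ℝ) < k - lam) (hheavy : 3 ≤ w → ν < μ) :
    ∃ u : Fin w × Fin v → EuclideanSpace ℝ (Fin v), (∀ a, ∑ z, u a z = 0) ∧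
      (∀ i x y, ⟪u (i, x), u (i, y)⟫ = (if x = y then 1 else 0) - 1 / (v : ℝ)) ∧
      ∀ a b, a.1 ≠ b.1 → ⟪u a, u b⟫ = centredAdj k Γ a b / √((k : ℝ) - lam) := by
  have hv0 : 0 < v := by omega
  have hv' : (v : ℝ) ≠ 0 := by positivity
  have hs0 : √((k : ℝ) - lam) ≠ 0 := (Real.sqrt_pos.2 hs).ne'
  have hss : √((k : ℝ) - lam) * √((k : ℝ) - lam) = k - lam := Real.mul_self_sqrt hs.le
  let o : Fin w := ⟨0, by omega⟩
  let u : Fin w × Fin v → EuclideanSpace ℝ (Fin v) := fun a => WithLp.toLp 2 fun z =>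
    if a.1 = o then (if a.2 = z then 1 else 0) - 1 / (v : ℝ)
    else centredAdj k Γ a (o, z) / √((k : ℝ) - lam)
  have hu_base : ∀ x z, u (o, x) z = (if x = z then 1 else 0) - 1 / (v : ℝ) := fun x z => by
    simp [u]
  have hu_ne : ∀ a, a.1 ≠ o → ∀ z, u a z = centredAdj k Γ a (o, z) / √((k : ℝ) - lam) :=
    fun a ha z => by simp [u, ha]
  have hsum : ∀ a, ∑ z, u a z = 0 := by
    rintro ⟨i, x⟩
    by_cases hi : i = o
    · subst hi
      simp only [hu_base, Finset.sum_sub_distrib]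
      simp [hv']
    · simp only [hu_ne (i, x) hi, ← Finset.sum_div, hΓ.sum_centredAdj hv0 (a := (i, x)) (Ne.symm hi),
        zero_div]
  have hinner : ∀ a b, ⟪u a, u b⟫ = ∑ z, u a z * u b z := fun a b => by
    simp [PiLp.inner_apply, mul_comm]
  have hbase : ∀ x b, ⟪u (o, x), u b⟫ = u b x := fun x b => by
    simp only [hinner, hu_base, sub_mul, Finset.sum_sub_distrib, ← Finset.mul_sum, hsum b]
    simp
  refine ⟨u, hsum, fun i x y => ?_, ?_⟩
  · by_cases hi : i = o
    · subst hi
      rw [hbase, hu_base]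
      simp [eq_comm]
    · simp only [hinner, hu_ne (i, x) hi, hu_ne (i, y) hi, div_mul_div_comm, ← Finset.sum_div,
        hΓ.sum_centredAdj_mul_same hv0 hw (Ne.symm hi) x y, hss]
      field_simp
  · rintro ⟨i, x⟩ ⟨j, y⟩ (hij : i ≠ j)
    by_cases hi : i = o
    · subst hi
      rw [hbase, hu_ne (j, y) hij.symm, centredAdj_comm]
    by_cases hj : j = o
    · subst hj
      rw [real_inner_comm, hbase, hu_ne (i, x) hij]
    have hw3 : 3 ≤ w := by
      have h₁ := i.2
      have h₂ := j.2
      simp only [Fin.ext_iff, o] at hi hj hij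
      omega
    have hμ : (μ : ℝ) - ν = √((k : ℝ) - lam) := by
      rw [← hΓ.sub_sq hv hw hs (Ne.symm hi) (Ne.symm hj) hij, Real.sqrt_sq]
      have : (ν : ℝ) < μ := by exact_mod_cast hheavy hw3
      linarith
    simp only [hinner, hu_ne (i, x) hi, hu_ne (j, y) hj, div_mul_div_comm, ← Finset.sum_div,
      hΓ.sum_centredAdj_mul_distinct hv0 (Ne.symm hi) (Ne.symm hj) hij x y, hμ]
    field_simp

end IsLSSD

/-- A μ-heavy `LSSD(v,k,λ;w)` with `1 < k < v-1` yields, via the first idempotent of its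
association scheme, a set of `w` linked simplices in ℝ^{v-1}: unit vectors with inner
product `-1/(v-1)` inside fibers, `(v-k)/((v-1)√(k-λ))` on edges, and
`-k/((v-1)√(k-λ))` on non-edges between distinct fibers. -/
theorem stmt_5 (v k lam w : ℕ) (hw : 2 ≤ w) (hk1 : 1 < k) (hk2 : k < v - 1)
    (Γ : SimpleGraph (Fin w × Fin v)) (μ ν : ℕ)
    (hΓ : IsLSSD v k lam Γ μ ν)
    (hheavy : 3 ≤ w → ν < μ) :
    ∃ x : Fin w × Fin v → EuclideanSpace ℝ (Fin (v - 1)),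
      (∀ a, ‖x a‖ = 1) ∧
      ∀ a b : Fin w × Fin v, a ≠ b →
        (a.1 = b.1 → ⟪x a, x b⟫ = -1 / ((v : ℝ) - 1)) ∧
        (Γ.Adj a b →
          ⟪x a, x b⟫ = ((v : ℝ) - k) / (((v : ℝ) - 1) * Real.sqrt ((k : ℝ) - lam))) ∧
        (a.1 ≠ b.1 → ¬ Γ.Adj a b →
          ⟪x a, x b⟫ = -(k : ℝ) / (((v : ℝ) - 1) * Real.sqrt ((k : ℝ) - lam))) := by
  have hv : 1 < v := by omega
  have hv1 : (1 : ℝ) < v := by exact_mod_cast hv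
  have hkv : (k : ℝ) < v := by exact_mod_cast (by omega : k < v)
  have hk0 : (0 : ℝ) < k := by exact_mod_cast (by omega : 0 < k)
  have hs : (0 : ℝ) < k - lam := by
    have hl := hΓ.lam_mul (by omega) hw
    refine pos_of_mul_pos_left (b := (v : ℝ) - 1) ?_ (by linarith)
    nlinarith [mul_pos hk0 (sub_pos.2 hkv)]
  obtain ⟨u, hsum, hsame, hdiff⟩ := hΓ.exists_gram hv hw hs hheavy
  obtain ⟨y, hy⟩ := exists_inner_eq_of_sum_eq_zero (by omega) u hsum
  have hv0 : (v : ℝ) ≠ 0 := by positivity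
  have hvs : (v : ℝ) - 1 ≠ 0 := by linarith
  have hs0 : √((k : ℝ) - lam) ≠ 0 := (Real.sqrt_pos.2 hs).ne'
  have hc : √((v : ℝ) / (v - 1)) * √((v : ℝ) / (v - 1)) = v / (v - 1) :=
    Real.mul_self_sqrt (div_nonneg (by linarith) (by linarith))
  have hin : ∀ a b, ⟪√((v : ℝ) / (v - 1)) • y a, √((v : ℝ) / (v - 1)) • y b⟫ =
      v / (v - 1) * ⟪u a, u b⟫ := fun a b => by
    rw [real_inner_smul_left, real_inner_smul_right, hy, ← mul_assoc, hc]
  refine ⟨fun a => √((v : ℝ) / (v - 1)) • y a, fun a => ?_, fun a b hab => ⟨?_, ?_, ?_⟩⟩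
  · rw [← sq_eq_sq₀ (norm_nonneg _) zero_le_one, ← real_inner_self_eq_norm_sq, hin,
      hsame a.1 a.2 a.2, if_pos rfl]
    field_simp
  · obtain ⟨i, x⟩ := a
    obtain ⟨j, z⟩ := b
    rintro (rfl : i = j)
    rw [hin, hsame, if_neg (fun h => hab (by rw [h]))]
    field_simp
    ring
  · intro hA
    rw [hin, hdiff a b (hΓ.1 a b hA)]
    simp only [centredAdj, SimpleGraph.adjMatrix_apply, if_pos hA]
    field_simp
  · intro hne hA
    rw [hin, hdiff a b hne]
    simp only [centredAdj, SimpleGraph.adjMatrix_apply, if_neg hA]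
    field_simp
    ring
end

section
/- Let v, k, λ, w be integers with w ≥ 2, 1 < k < v − 1, k(k−1) = λ(v−1), and v − 2k = −2s where s = √(k−λ) is a positive integer. Then there exists a μ-heavy linked system of symmetric designs LSSD(v,k,λ;w) (μ > ν when w ≥ 3; this is the optimistic case since 2k > v) if and only if there exists a family H_2, …, H_w of w − 1 mutually unbiased regular Hadamard matrices of order v with all row and column sums equal to 2s, i.e., H_i·J = J·H_i = 2s·J for each i. -/
/-- A Hadamard matrix: entries `±1` and `H Hᵀ = n I`. -/
def IsHadamardMatrix {n : ℕ} (H : Matrix (Fin n) (Fin n) ℝ) : Prop :=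
  (∀ i j, H i j = 1 ∨ H i j = -1) ∧
    H * H.transpose = (n : ℝ) • (1 : Matrix (Fin n) (Fin n) ℝ)

/-- Two Hadamard matrices of order `n` are unbiased if `(1/√n) H Kᵀ` is again Hadamard. -/
def UnbiasedHadamard {n : ℕ} (H K : Matrix (Fin n) (Fin n) ℝ) : Prop :=
  IsHadamardMatrix ((Real.sqrt n)⁻¹ • (H * K.transpose))

/-- A symmetric design with `v + 2s = 2k` and `s² = k - λ` has Menon parameters. -/
theorem menon_parameters {v k lam s : ℕ} (hk1 : 1 < k) (hk2 : k < v - 1)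
    (hdesign : k * (k - 1) = lam * (v - 1)) (hs2 : lam + s ^ 2 = k)
    (hopt : v + 2 * s = 2 * k) :
    v = 4 * s ^ 2 ∧ k = 2 * s ^ 2 + s ∧ lam = s ^ 2 + s := by
  have hk : k = 2 * s ^ 2 + s := by
    have hd : (k : ℤ) * (k - 1) = lam * (v - 1) := by
      have h := congrArg (Nat.cast (R := ℤ)) hdesign
      rwa [Nat.cast_mul, Nat.cast_mul, Nat.cast_sub (by omega), Nat.cast_sub (by omega),
        Nat.cast_one] at h
    have hv : (v : ℤ) = 2 * k - 2 * s := by linarith [(by exact_mod_cast hopt :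
      (v : ℤ) + 2 * s = 2 * k)]
    have hl : (lam : ℤ) = k - s ^ 2 := by linarith [(by exact_mod_cast hs2 :
      (lam : ℤ) + (s : ℤ) ^ 2 = k)]
    rw [hv, hl] at hd
    have hprod : ((k : ℤ) - s) * (k - (2 * s ^ 2 + s)) = 0 := by linear_combination -hd
    rcases mul_eq_zero.mp hprod with h | h
    · omega
    · exact_mod_cast sub_eq_zero.mp h
  refine ⟨?_, hk, ?_⟩ <;> omega

open Classical in
theorem two_mul_ncard_eq_one {n : ℕ} {f : Fin n → ℝ} (hf : ∀ z, f z = 1 ∨ f z = -1) :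
    2 * ({z | f z = 1}.ncard : ℝ) = ∑ z, f z + n := by
  have hcard : ({z | f z = 1}.ncard : ℝ) = ∑ z, if f z = 1 then (1 : ℝ) else 0 := by
    rw [Set.ncard_eq_toFinset_card', Finset.sum_boole]
    simp
  have hn : (n : ℝ) = ∑ _z : Fin n, (1 : ℝ) := by simp
  rw [hcard, hn, Finset.mul_sum, ← Finset.sum_add_distrib]
  refine Finset.sum_congr rfl fun z _ => ?_
  rcases hf z with h | h <;> rw [h] <;> norm_num

open Classical in
theorem four_mul_ncard_eq_one_and_eq_one {n : ℕ} {f g : Fin n → ℝ}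
    (hf : ∀ z, f z = 1 ∨ f z = -1) (hg : ∀ z, g z = 1 ∨ g z = -1) :
    4 * ({z | f z = 1 ∧ g z = 1}.ncard : ℝ) = ∑ z, f z * g z + ∑ z, f z + ∑ z, g z + n := by
  have hcard : ({z | f z = 1 ∧ g z = 1}.ncard : ℝ) =
      ∑ z, if f z = 1 ∧ g z = 1 then (1 : ℝ) else 0 := by
    rw [Set.ncard_eq_toFinset_card', Finset.sum_boole]
    simp
  have hn : (n : ℝ) = ∑ _z : Fin n, (1 : ℝ) := by simp
  rw [hcard, hn, Finset.mul_sum, ← Finset.sum_add_distrib, ← Finset.sum_add_distrib,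
    ← Finset.sum_add_distrib]
  refine Finset.sum_congr rfl fun z _ => ?_
  rcases hf z with h | h <;> rcases hg z with h' | h' <;> rw [h, h'] <;> norm_num

theorem transpose_mul_self_eq_smul_one {n : ℕ} {H : Matrix (Fin n) (Fin n) ℝ}
    (h : H * H.transpose = (n : ℝ) • (1 : Matrix (Fin n) (Fin n) ℝ)) :
    H.transpose * H = (n : ℝ) • (1 : Matrix (Fin n) (Fin n) ℝ) := by
  rcases Nat.eq_zero_or_pos n with rfl | hn
  · exact Subsingleton.elim _ _
  have hn' : (n : ℝ) ≠ 0 := by positivity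
  have h1 : H * ((n : ℝ)⁻¹ • H.transpose) = 1 := by
    rw [Matrix.mul_smul, h, smul_smul, inv_mul_cancel₀ hn', one_smul]
  have h2 := mul_eq_one_comm.mp h1
  rw [Matrix.smul_mul] at h2
  rw [← h2, smul_smul, mul_inv_cancel₀ hn', one_smul]

/-- The row sums of `A Bᵀ`, when the row sums of `A` and the column sums of `B` are constant. -/
theorem sum_mul_transpose_row {n : ℕ} {A B : Matrix (Fin n) (Fin n) ℝ} {a b : ℝ}
    (hA : ∀ i, ∑ j, A i j = a) (hB : ∀ j, ∑ i, B i j = b) (i : Fin n) :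
    ∑ j, (A * B.transpose) i j = a * b := by
  simp only [Matrix.mul_apply, Matrix.transpose_apply]
  rw [Finset.sum_comm]
  simp only [← Finset.mul_sum, hB]
  rw [← Finset.sum_mul, hA]

/-- The `±1` matrix of adjacency between the fibers `i` and `j`. -/
noncomputable def fiberSignMatrix {w v : ℕ} (Γ : SimpleGraph (Fin w × Fin v)) (i j : Fin w) :
    Matrix (Fin v) (Fin v) ℝ :=
  open Classical in Matrix.of fun x y => if Γ.Adj (i, x) (j, y) then 1 else -1

section fiberSignMatrix

variable {w v : ℕ} (Γ : SimpleGraph (Fin w × Fin v)) (i j : Fin w)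

theorem fiberSignMatrix_eq_one_or (x y : Fin v) :
    fiberSignMatrix Γ i j x y = 1 ∨ fiberSignMatrix Γ i j x y = -1 := by
  simp only [fiberSignMatrix, Matrix.of_apply]
  split_ifs <;> simp

theorem fiberSignMatrix_eq_one_iff (x y : Fin v) :
    fiberSignMatrix Γ i j x y = 1 ↔ Γ.Adj (i, x) (j, y) := by
  simp only [fiberSignMatrix, Matrix.of_apply]
  split_ifs with h
  · simp [h]
  · simp only [h, iff_false]
    norm_num

theorem fiberSignMatrix_transpose :
    (fiberSignMatrix Γ i j).transpose = fiberSignMatrix Γ j i := by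
  ext x y
  simp only [fiberSignMatrix, Matrix.of_apply, Matrix.transpose_apply]
  rw [Γ.adj_comm]

end fiberSignMatrix

section Forward

variable {v k lam s w μ ν : ℕ} {Γ : SimpleGraph (Fin w × Fin v)}

theorem IsLSSD.sum_fiberSignMatrix (hΓ : IsLSSD v k lam Γ μ ν) (hopt : v + 2 * s = 2 * k)
    {i j : Fin w} (hij : i ≠ j) (x : Fin v) : ∑ y, fiberSignMatrix Γ i j x y = 2 * s := by
  have h := two_mul_ncard_eq_one (fiberSignMatrix_eq_one_or Γ i j x)
  simp only [fiberSignMatrix_eq_one_iff] at h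
  rw [hΓ.2.1 (i, x) j hij.symm] at h
  have : (v : ℝ) + 2 * s = 2 * k := by exact_mod_cast hopt
  linarith

theorem IsLSSD.isHadamardMatrix_fiberSignMatrix (hΓ : IsLSSD v k lam Γ μ ν)
    (hopt : v + 2 * s = 2 * k) (hv : v = 4 * s ^ 2) (hs2 : lam + s ^ 2 = k)
    {i j : Fin w} (hij : i ≠ j) : IsHadamardMatrix (fiberSignMatrix Γ i j) := by
  refine ⟨fiberSignMatrix_eq_one_or Γ i j, ?_⟩
  ext x y
  simp only [Matrix.mul_apply, Matrix.transpose_apply, Matrix.smul_apply, smul_eq_mul]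
  by_cases hxy : x = y
  · subst hxy
    have hone : ∀ z, fiberSignMatrix Γ i j x z * fiberSignMatrix Γ i j x z = 1 := fun z => by
      rcases fiberSignMatrix_eq_one_or Γ i j x z with h | h <;> rw [h] <;> norm_num
    simp [hone]
  · have h := four_mul_ncard_eq_one_and_eq_one (fiberSignMatrix_eq_one_or Γ i j x)
      (fiberSignMatrix_eq_one_or Γ i j y)
    simp only [fiberSignMatrix_eq_one_iff] at h
    rw [hΓ.2.2.1 i x y hxy j hij.symm, hΓ.sum_fiberSignMatrix hopt hij,
      hΓ.sum_fiberSignMatrix hopt hij] at h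
    rw [Matrix.one_apply_ne hxy, mul_zero]
    have h1 : (v : ℝ) + 2 * s = 2 * k := by exact_mod_cast hopt
    have h2 : (v : ℝ) = 4 * s ^ 2 := by exact_mod_cast hv
    have h3 : (lam : ℝ) + s ^ 2 = k := by exact_mod_cast hs2
    linarith

/-- Composing the designs through a third fiber gives back the direct design, scaled by `2s`. -/
theorem IsLSSD.fiberSignMatrix_mul_transpose (hΓ : IsLSSD v k lam Γ μ ν)
    (hopt : v + 2 * s = 2 * k) (hv : v = 4 * s ^ 2) (hs2 : lam + s ^ 2 = k) (hs : 0 < s)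
    (hμν : ν < μ) {h i j : Fin w} (hih : i ≠ h) (hjh : j ≠ h) (hij : i ≠ j) :
    fiberSignMatrix Γ i h * (fiberSignMatrix Γ j h).transpose =
      (2 * s : ℝ) • fiberSignMatrix Γ i j := by
  have hvR : (v : ℝ) = 4 * s ^ 2 := by exact_mod_cast hv
  have hsR : (1 : ℝ) ≤ s := by exact_mod_cast hs
  set C := fiberSignMatrix Γ i h * (fiberSignMatrix Γ j h).transpose with hC
  set M := fiberSignMatrix Γ i j with hM
  obtain ⟨a, ha⟩ : ∃ a : ℝ, a = 2 * (μ - ν) := ⟨_, rfl⟩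
  obtain ⟨b, hb⟩ : ∃ b : ℝ, b = 2 * (μ + ν) - 4 * s - v := ⟨_, rfl⟩
  have hapos : 0 < a := by
    have : (ν : ℝ) < μ := by exact_mod_cast hμν
    linarith
  have hCM : ∀ x y, C x y = a * M x y + b := by
    intro x y
    have hcount := four_mul_ncard_eq_one_and_eq_one (fiberSignMatrix_eq_one_or Γ i h x)
      (fiberSignMatrix_eq_one_or Γ j h y)
    simp only [fiberSignMatrix_eq_one_iff] at hcount
    rw [hΓ.sum_fiberSignMatrix hopt hih, hΓ.sum_fiberSignMatrix hopt hjh] at hcount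
    have hCxy : C x y = ∑ z, fiberSignMatrix Γ i h x z * fiberSignMatrix Γ j h y z := by
      simp only [hC, Matrix.mul_apply, Matrix.transpose_apply]
    have hlink := hΓ.2.2.2 h i j hih.symm hjh.symm hij x y
    rcases fiberSignMatrix_eq_one_or Γ i j x y with hm | hm
    · rw [hlink.1 ((fiberSignMatrix_eq_one_iff Γ i j x y).mp hm)] at hcount
      rw [hM, hm]
      linarith
    · rw [hlink.2 (fun hadj => by
        rw [(fiberSignMatrix_eq_one_iff Γ i j x y).mpr hadj] at hm; norm_num at hm)] at hcount
      rw [hM, hm]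
      linarith
  have hHi := hΓ.isHadamardMatrix_fiberSignMatrix hopt hv hs2 hih
  have hHj := hΓ.isHadamardMatrix_fiberSignMatrix hopt hv hs2 hjh
  have hCC : C * C.transpose = ((v : ℝ) * v) • (1 : Matrix (Fin v) (Fin v) ℝ) := by
    rw [hC, Matrix.transpose_mul, Matrix.transpose_transpose, Matrix.mul_assoc,
      ← Matrix.mul_assoc _ _ (fiberSignMatrix Γ i h).transpose,
      transpose_mul_self_eq_smul_one hHj.2, Matrix.smul_mul, Matrix.one_mul, Matrix.mul_smul,
      hHi.2, smul_smul]
  obtain ⟨hb0, ha0⟩ | hempty : (b = 0 ∧ a = 2 * s) ∨ IsEmpty (Fin v) := by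
    rcases isEmpty_or_nonempty (Fin v) with he | ⟨⟨x⟩⟩
    · exact Or.inr he
    left
    have hMsum : ∑ y, M x y = 2 * s := hΓ.sum_fiberSignMatrix hopt hij x
    have hrow : 2 * s * a + v * b = v := by
      have hsum : ∑ y, C x y = (2 * s) * (2 * s) :=
        sum_mul_transpose_row (hΓ.sum_fiberSignMatrix hopt hih) (fun z => by
          have := hΓ.sum_fiberSignMatrix hopt hjh.symm z
          rw [← fiberSignMatrix_transpose] at this
          simpa only [Matrix.transpose_apply] using this) x
      simp only [hCM, Finset.sum_add_distrib, ← Finset.mul_sum, hMsum, Finset.sum_const,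
        Finset.card_univ, Fintype.card_fin, nsmul_eq_mul] at hsum
      linarith
    have hsq : v * a ^ 2 + 2 * a * b * (2 * s) + v * b ^ 2 = v * v := by
      have hdiag := congrFun (congrFun hCC x) x
      have hMM : ∀ y, C x y * C x y = (a ^ 2 + b ^ 2) + (2 * a * b) * M x y := fun y => by
        rw [hCM]
        rcases fiberSignMatrix_eq_one_or Γ i j x y with hm | hm <;> rw [hM, hm] <;> ring
      simp only [Matrix.mul_apply, Matrix.transpose_apply, hMM, Finset.sum_add_distrib,
        ← Finset.mul_sum, hMsum, Finset.sum_const, Finset.card_univ, Fintype.card_fin,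
        nsmul_eq_mul, Matrix.smul_apply, Matrix.one_apply_eq, smul_eq_mul] at hdiag
      linarith
    rw [hvR] at hrow hsq
    have hs0 : (s : ℝ) ≠ 0 := by positivity
    have ha' : a = 2 * s * (1 - b) := by
      apply mul_left_cancel₀ (mul_ne_zero two_ne_zero hs0)
      linear_combination hrow
    have hb' : b * (b - 2) = 0 := by
      have hne : 4 * (s : ℝ) ^ 2 * (4 * s ^ 2 - 1) ≠ 0 := by
        have : (1 : ℝ) ≤ s ^ 2 := by nlinarith
        exact mul_ne_zero (by positivity) (by linarith)
      apply mul_left_cancel₀ hne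
      rw [ha'] at hsq
      linear_combination hsq
    rcases mul_eq_zero.mp hb' with hb0 | hb2
    · exact ⟨hb0, by rw [ha', hb0]; ring⟩
    · exfalso
      have : b = 2 := by linarith
      rw [this] at ha'
      linarith
  · ext x y
    rw [hCM, hb0, ha0, add_zero, Matrix.smul_apply, smul_eq_mul]
  · ext x
    exact hempty.elim x

end Forward

theorem sqrt_four_mul_sq {v s : ℕ} (hv : v = 4 * s ^ 2) : Real.sqrt v = 2 * s := by
  rw [show (v : ℝ) = (2 * s) ^ 2 by rw [hv]; push_cast; ring]
  exact Real.sqrt_sq (by positivity)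

/-- The graph with `(i, x)` and `(j, y)` adjacent when `i ≠ j` and the `(x, y)` entry of
`M i j` is `1`. -/
def signMatrixGraph {w v : ℕ} (M : Fin w → Fin w → Matrix (Fin v) (Fin v) ℝ)
    (hM : ∀ i j, (M i j).transpose = M j i) : SimpleGraph (Fin w × Fin v) where
  Adj a b := a.1 ≠ b.1 ∧ M a.1 b.1 a.2 b.2 = 1
  symm := ⟨fun a b h => ⟨h.1.symm, by
    rw [← hM, Matrix.transpose_apply]; exact h.2⟩⟩
  loopless := ⟨fun _ h => h.1 rfl⟩

/-- A linked system of regular Hadamard matrices yields a linked system of symmetric designs. -/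
theorem isLSSD_signMatrixGraph {w v s : ℕ} {M : Fin w → Fin w → Matrix (Fin v) (Fin v) ℝ}
    (hv : v = 4 * s ^ 2) (hT : ∀ i j, (M i j).transpose = M j i)
    (hH : ∀ i j, i ≠ j → IsHadamardMatrix (M i j))
    (hsum : ∀ i j x, ∑ y, M i j x y = 2 * s)
    (hlink : ∀ h i j, M i h * (M j h).transpose = (2 * s : ℝ) • M i j) :
    IsLSSD v (2 * s ^ 2 + s) (s ^ 2 + s) (signMatrixGraph M hT)
      ((2 * s ^ 2 + 3 * s) / 2) ((2 * s ^ 2 + s) / 2) := by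
  have hvR : (v : ℝ) = 4 * s ^ 2 := by exact_mod_cast hv
  have hAdj : ∀ {i j : Fin w}, i ≠ j → ∀ x y,
      ((signMatrixGraph M hT).Adj (i, x) (j, y) ↔ M i j x y = 1) :=
    fun hij _ _ => ⟨fun h => h.2, fun h => ⟨hij, h⟩⟩
  refine ⟨fun a b h => h.1, ?_, ?_, ?_⟩
  · rintro ⟨i, x⟩ j hji
    have h := two_mul_ncard_eq_one ((hH i j (Ne.symm hji)).1 x)
    simp only [hAdj (Ne.symm hji)]
    rw [hsum, hvR] at h
    have h' : ({y | M i j x y = 1}.ncard : ℝ) = ((2 * s ^ 2 + s : ℕ) : ℝ) := by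
      push_cast; linarith
    exact_mod_cast h'
  · intro i x y hxy j hji
    have hHij := hH i j (Ne.symm hji)
    have h := four_mul_ncard_eq_one_and_eq_one (hHij.1 x) (hHij.1 y)
    simp only [hAdj (Ne.symm hji)]
    have horth := congrFun (congrFun hHij.2 x) y
    simp only [Matrix.mul_apply, Matrix.transpose_apply, Matrix.smul_apply,
      Matrix.one_apply_ne hxy, smul_zero] at horth
    rw [hsum, hsum, horth, hvR] at h
    have h' : ({z | M i j x z = 1 ∧ M i j y z = 1}.ncard : ℝ) = ((s ^ 2 + s : ℕ) : ℝ) := by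
      push_cast; linarith
    exact_mod_cast h'
  · intro h i j hhi hhj hij x y
    have hcount := four_mul_ncard_eq_one_and_eq_one ((hH i h hhi.symm).1 x)
      ((hH j h hhj.symm).1 y)
    simp only [hAdj hhi.symm, hAdj hhj.symm, hAdj hij]
    have hprod := congrFun (congrFun (hlink h i j) x) y
    simp only [Matrix.mul_apply, Matrix.transpose_apply, Matrix.smul_apply,
      smul_eq_mul] at hprod
    rw [hsum, hsum, hprod, hvR] at hcount
    generalize {z | M i h x z = 1 ∧ M j h y z = 1}.ncard = c at hcount ⊢
    refine ⟨fun hm => ?_, fun hm => ?_⟩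
    · rw [hm] at hcount
      have : 2 * c = 2 * s ^ 2 + 3 * s := by
        have h' : 2 * (c : ℝ) = 2 * s ^ 2 + 3 * s := by linarith
        exact_mod_cast h'
      omega
    · rw [((hH i j hij).1 x y).resolve_left hm] at hcount
      have : 2 * c = 2 * s ^ 2 + s := by
        have h' : 2 * (c : ℝ) = 2 * s ^ 2 + s := by linarith
        exact_mod_cast h'
      omega

/-- Adjoining `2s I` to a family of mutually unbiased regular Hadamard matrices of order
`4s²` and taking normalised products gives an LSSD. -/
theorem exists_isLSSD_of_unbiased {m v s : ℕ} (hs : 0 < s) (hv : v = 4 * s ^ 2)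
    {H : Fin m → Matrix (Fin v) (Fin v) ℝ} (hH : ∀ t, IsHadamardMatrix (H t))
    (hrow : ∀ t i, ∑ j, H t i j = 2 * s) (hcol : ∀ t j, ∑ i, H t i j = 2 * s)
    (hunb : ∀ t t', t ≠ t' → UnbiasedHadamard (H t) (H t')) :
    ∃ Γ : SimpleGraph (Fin (m + 1) × Fin v), IsLSSD v (2 * s ^ 2 + s) (s ^ 2 + s) Γ
      ((2 * s ^ 2 + 3 * s) / 2) ((2 * s ^ 2 + s) / 2) := by
  have hvR : (v : ℝ) = (2 * s) * (2 * s) := by rw [hv]; push_cast; ring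
  have hs0 : (2 * s : ℝ) ≠ 0 := by positivity
  let N : Fin (m + 1) → Matrix (Fin v) (Fin v) ℝ :=
    Fin.cons ((2 * s : ℝ) • (1 : Matrix (Fin v) (Fin v) ℝ)) H
  have hN0 : N 0 = (2 * s : ℝ) • (1 : Matrix (Fin v) (Fin v) ℝ) := rfl
  have hNs : ∀ t : Fin m, N t.succ = H t := fun _ => rfl
  have hNN : ∀ i, N i * (N i).transpose = (v : ℝ) • (1 : Matrix (Fin v) (Fin v) ℝ) := by
    intro i
    refine Fin.cases ?_ (fun t => (hH t).2) i
    simp [hN0, smul_smul, hvR]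
  have hNN' := fun i => transpose_mul_self_eq_smul_one (hNN i)
  have hNrow : ∀ i x, ∑ y, N i x y = 2 * s := by
    intro i
    refine Fin.cases (fun x => ?_) hrow i
    simp [hN0, Matrix.one_apply]
  have hNcol : ∀ i y, ∑ x, N i x y = 2 * s := by
    intro i
    refine Fin.cases (fun x => ?_) hcol i
    simp [hN0, Matrix.one_apply]
  let M : Fin (m + 1) → Fin (m + 1) → Matrix (Fin v) (Fin v) ℝ :=
    fun i j => (2 * s : ℝ)⁻¹ • (N i * (N j).transpose)
  have hM : ∀ i j, M i j = (2 * s : ℝ)⁻¹ • (N i * (N j).transpose) := fun _ _ => rfl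
  have hT : ∀ i j, (M i j).transpose = M j i := fun i j => by
    simp only [hM, Matrix.transpose_smul, Matrix.transpose_mul, Matrix.transpose_transpose]
  have hMM : ∀ h i j, M i h * (M j h).transpose = N i * (N j).transpose := by
    intro h i j
    rw [hT, hM, hM, Matrix.smul_mul, Matrix.mul_smul, Matrix.mul_assoc,
      ← Matrix.mul_assoc _ _ (N j).transpose, hNN', Matrix.smul_mul, Matrix.one_mul,
      Matrix.mul_smul, smul_smul, smul_smul, hvR, show (2 * s : ℝ)⁻¹ * (2 * s : ℝ)⁻¹ *
        (2 * s * (2 * s)) = 1 by field_simp, one_smul]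
  have hentry : ∀ i j, i ≠ j → ∀ x y, M i j x y = 1 ∨ M i j x y = -1 := by
    intro i j
    refine Fin.cases ?_ (fun t => ?_) i <;> refine Fin.cases ?_ (fun t' => ?_) j
    · exact fun h => absurd rfl h
    · intro _ x y
      have : M 0 t'.succ x y = H t' y x := by
        simp only [hM, hN0, hNs, Matrix.smul_mul, Matrix.one_mul, smul_smul,
          inv_mul_cancel₀ hs0, one_smul, Matrix.transpose_apply]
      rw [this]
      exact (hH t').1 y x
    · intro _ x y
      have : M t.succ 0 x y = H t x y := by
        simp only [hM, hN0, hNs, Matrix.transpose_smul, Matrix.transpose_one, Matrix.mul_smul,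
          Matrix.mul_one, smul_smul, inv_mul_cancel₀ hs0, one_smul]
      rw [this]
      exact (hH t).1 x y
    · intro hne x y
      have h := (hunb t t' fun h => hne (by rw [h])).1 x y
      rwa [sqrt_four_mul_sq hv] at h
  refine ⟨signMatrixGraph M hT, isLSSD_signMatrixGraph hv hT
    (fun i j hij => ⟨hentry i j hij, by rw [hMM, hNN]⟩) (fun i j x => ?_) (fun h i j => ?_)⟩
  · simp only [hM, Matrix.smul_apply, smul_eq_mul, ← Finset.mul_sum]
    rw [sum_mul_transpose_row (hNrow i) (hNcol j), inv_mul_cancel_left₀ hs0]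
  · rw [hMM, hM, smul_smul, mul_inv_cancel₀ hs0, one_smul]

/-- For symmetric design parameters with `s = √(k-λ)` and `v - 2k = -2s` (the optimistic
case), a μ-heavy `LSSD(v,k,λ;w)` exists iff there exist `w - 1` mutually unbiased regular
Hadamard matrices of order `v` with all row and column sums equal to `2s`. -/
theorem stmt_6 (v k lam s w : ℕ) (hw : 2 ≤ w) (hk1 : 1 < k) (hk2 : k < v - 1)
    (hdesign : k * (k - 1) = lam * (v - 1)) (hs : 0 < s) (hs2 : lam + s ^ 2 = k)
    (hopt : v + 2 * s = 2 * k) :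
    (∃ (Γ : SimpleGraph (Fin w × Fin v)) (μ ν : ℕ),
        IsLSSD v k lam Γ μ ν ∧ (3 ≤ w → ν < μ)) ↔
    (∃ H : Fin (w - 1) → Matrix (Fin v) (Fin v) ℝ,
        (∀ t, IsHadamardMatrix (H t)) ∧
        (∀ t i, ∑ j, H t i j = 2 * s) ∧
        (∀ t j, ∑ i, H t i j = 2 * s) ∧
        (∀ t t', t ≠ t' → UnbiasedHadamard (H t) (H t'))) := by
  obtain ⟨hv, hk, hlam⟩ := menon_parameters hk1 hk2 hdesign hs2 hopt
  obtain ⟨m, rfl⟩ : ∃ m, w = m + 1 := ⟨w - 1, by omega⟩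
  rw [Nat.add_sub_cancel]
  constructor
  · rintro ⟨Γ, μ, ν, hΓ, hμν⟩
    have hne : ∀ t : Fin m, t.succ ≠ 0 := Fin.succ_ne_zero
    refine ⟨fun t => fiberSignMatrix Γ t.succ 0,
      fun t => hΓ.isHadamardMatrix_fiberSignMatrix hopt hv hs2 (hne t),
      fun t => hΓ.sum_fiberSignMatrix hopt (hne t), fun t y => ?_, fun t t' htt' => ?_⟩
    · have h := hΓ.sum_fiberSignMatrix hopt (hne t).symm y
      rw [← fiberSignMatrix_transpose] at h
      simpa only [Matrix.transpose_apply] using h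
    · have hsucc : t.succ ≠ t'.succ := fun h => htt' (Fin.succ_injective _ h)
      have hm : 3 ≤ m + 1 := by
        have := Fin.val_ne_of_ne htt'
        omega
      rw [UnbiasedHadamard, hΓ.fiberSignMatrix_mul_transpose hopt hv hs2 hs (hμν hm) (hne t)
        (hne t') hsucc, sqrt_four_mul_sq hv, smul_smul, inv_mul_cancel₀ (by positivity),
        one_smul]
      exact hΓ.isHadamardMatrix_fiberSignMatrix hopt hv hs2 hsucc
  · rintro ⟨H, hH, hrow, hcol, hunb⟩
    obtain ⟨Γ, hΓ⟩ := exists_isLSSD_of_unbiased hs hv hH hrow hcol hunb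
    rw [hk, hlam]
    exact ⟨Γ, _, _, hΓ, fun _ => by omega⟩
end

section
/- Let n ≥ 1 and N ≥ 2 be integers. Suppose there exists a regular Hadamard matrix of order n, and suppose there exists an orthogonal array of size n² × N on n symbols, i.e., an n² × N array with entries from an n-element symbol set such that for any two distinct columns, every ordered pair of symbols occurs in exactly one row. Then there exist N − 1 mutually unbiased regular Hadamard matrices of order n², each with all row and column sums equal to n. -/
open Matrix Kronecker

section

variable {m ι : Type*} [DecidableEq m]

/-- Block-diagonal copies of `A`, with the index set identified with `m × m` along `e`. -/
def blockCopies (A : Matrix m m ℝ) (e : ι ≃ m × m) : Matrix ι ι ℝ :=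
  ((1 : Matrix m m ℝ) ⊗ₖ A).submatrix e e

lemma blockCopies_apply (A : Matrix m m ℝ) (e : ι ≃ m × m) (i j : ι) :
    blockCopies A e i j = if (e i).1 = (e j).1 then A (e i).2 (e j).2 else 0 := by
  simp [blockCopies, Matrix.kroneckerMap_apply, Matrix.one_apply]

variable [Fintype ι]

/-- If the blocks of `e` and `f` meet in exactly one point, then the rows of the two block matrices
have inner products `±1`. -/
lemma blockCopies_mul_transpose_apply {A : Matrix m m ℝ} (hA : ∀ i j, A i j = 1 ∨ A i j = -1)
    {e f : ι ≃ m × m} (hef : ∀ p q, ∃! r, (e r).1 = p ∧ (f r).1 = q) (i j : ι) :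
    (blockCopies A e * (blockCopies A f)ᵀ) i j = 1 ∨
      (blockCopies A e * (blockCopies A f)ᵀ) i j = -1 := by
  obtain ⟨r, ⟨hr1, hr2⟩, hr⟩ := hef (e i).1 (f j).1
  have key : (blockCopies A e * (blockCopies A f)ᵀ) i j =
      A (e i).2 (e r).2 * A (f j).2 (f r).2 := by
    rw [Matrix.mul_apply, Finset.sum_eq_single r]
    · simp [blockCopies_apply, hr1, hr2]
    · intro s _ hs
      simp only [Matrix.transpose_apply, blockCopies_apply]
      split_ifs with h1 h2
      · exact absurd (hr s ⟨h1.symm, h2.symm⟩) hs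
      all_goals simp
    · simp
  rw [key]
  rcases hA (e i).2 (e r).2 with h1 | h1 <;> rcases hA (f j).2 (f r).2 with h2 | h2 <;>
    simp [h1, h2]

variable [Fintype m]

lemma transpose_mul_self_of_mul_transpose_self {A : Matrix m m ℝ} {a : ℝ} (ha : a ≠ 0)
    (h : A * Aᵀ = a • (1 : Matrix m m ℝ)) : Aᵀ * A = a • (1 : Matrix m m ℝ) := by
  have h1 : A * (a⁻¹ • Aᵀ) = 1 := by
    rw [Matrix.mul_smul, h, smul_smul, inv_mul_cancel₀ ha, one_smul]
  have h2 := mul_eq_one_comm.mp h1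
  rw [Matrix.smul_mul] at h2
  rw [← h2, smul_smul, mul_inv_cancel₀ ha, one_smul]

/-- If a square matrix has constant row and column sums `c` and `A Aᵀ = a I`, then `c² = a`. -/
lemma sum_mul_sum_eq_of_mul_transpose_self [Nonempty m] {A : Matrix m m ℝ} {a c : ℝ}
    (h : A * Aᵀ = a • (1 : Matrix m m ℝ)) (hr : ∀ i, ∑ j, A i j = c)
    (hc : ∀ j, ∑ i, A i j = c) : c * c = a := by
  obtain ⟨i⟩ := ‹Nonempty m›
  have h1 : ∑ j, (A * Aᵀ) i j = c * c := by
    simp only [Matrix.mul_apply, Matrix.transpose_apply]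
    rw [Finset.sum_comm]
    simp only [← Finset.mul_sum, hc]
    rw [← Finset.sum_mul, hr]
  rw [← h1, h]
  simp [Matrix.one_apply]

lemma blockCopies_mul_transpose [DecidableEq ι] {A : Matrix m m ℝ} {a : ℝ}
    (h : A * Aᵀ = a • (1 : Matrix m m ℝ)) (e : ι ≃ m × m) :
    blockCopies A e * (blockCopies A e)ᵀ = a • (1 : Matrix ι ι ℝ) := by
  rw [blockCopies, Matrix.transpose_submatrix, Matrix.submatrix_mul_equiv,
    ← Matrix.kroneckerMap_transpose, ← Matrix.mul_kronecker_mul, h, Matrix.transpose_one,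
    Matrix.mul_one, Matrix.kronecker_smul, Matrix.one_kronecker_one]
  simp [Matrix.submatrix_smul]

lemma sum_blockCopies {A : Matrix m m ℝ} {c : ℝ} (h : ∀ i, ∑ j, A i j = c)
    (e : ι ≃ m × m) (i : ι) : ∑ j, blockCopies A e i j = c := by
  simp only [blockCopies_apply]
  rw [e.sum_comp (fun p => if (e i).1 = p.1 then A (e i).2 p.2 else 0), Fintype.sum_prod_type]
  simp [Finset.sum_ite_irrel, h]

lemma sum_blockCopies_left {A : Matrix m m ℝ} {c : ℝ} (h : ∀ j, ∑ i, A i j = c)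
    (e : ι ≃ m × m) (j : ι) : ∑ i, blockCopies A e i j = c := by
  simp only [blockCopies_apply]
  rw [e.sum_comp (fun p => if p.1 = (e j).1 then A p.2 (e j).2 else 0), Fintype.sum_prod_type]
  simp [Finset.sum_ite_irrel, h]

lemma sum_blockCopies_mul_transpose {A : Matrix m m ℝ} {c : ℝ} (hr : ∀ i, ∑ j, A i j = c)
    (hc : ∀ j, ∑ i, A i j = c) (e f : ι ≃ m × m) (i : ι) :
    ∑ j, (blockCopies A e * (blockCopies A f)ᵀ) i j = c * c := by
  simp only [Matrix.mul_apply, Matrix.transpose_apply]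
  rw [Finset.sum_comm]
  simp only [← Finset.mul_sum, sum_blockCopies_left hc]
  rw [← Finset.sum_mul, sum_blockCopies hr]

lemma sum_blockCopies_mul_transpose_left {A : Matrix m m ℝ} {c : ℝ}
    (hr : ∀ i, ∑ j, A i j = c) (hc : ∀ j, ∑ i, A i j = c) (e f : ι ≃ m × m) (j : ι) :
    ∑ i, (blockCopies A e * (blockCopies A f)ᵀ) i j = c * c := by
  rw [← sum_blockCopies_mul_transpose hr hc f e j]
  refine Finset.sum_congr rfl fun i _ => ?_
  simp only [Matrix.mul_apply, Matrix.transpose_apply, mul_comm]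

end

lemma isHadamardMatrix_blockCopies_mul_transpose {n : ℕ} (hn : 1 ≤ n)
    {A : Matrix (Fin n) (Fin n) ℝ} (hA : IsHadamardMatrix A)
    {e f : Fin (n ^ 2) ≃ Fin n × Fin n} (hef : ∀ p q, ∃! r, (e r).1 = p ∧ (f r).1 = q) :
    IsHadamardMatrix (blockCopies A e * (blockCopies A f)ᵀ) := by
  have hn0 : (n : ℝ) ≠ 0 := by positivity
  refine ⟨blockCopies_mul_transpose_apply hA.1 hef, ?_⟩
  have hf := transpose_mul_self_of_mul_transpose_self hn0 (blockCopies_mul_transpose hA.2 f)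
  rw [Matrix.transpose_mul, Matrix.transpose_transpose, Matrix.mul_assoc,
    ← Matrix.mul_assoc (blockCopies A f)ᵀ, hf, Matrix.smul_mul, Matrix.one_mul, Matrix.mul_smul,
    blockCopies_mul_transpose hA.2 e, smul_smul]
  congr 1
  push_cast
  ring

/-- Wocjan–Beth-type construction: a regular Hadamard matrix of order `n` together with an
orthogonal array of size `n² × N` on `n` symbols yields `N - 1` mutually unbiased regular
Hadamard matrices of order `n²` with all row and column sums equal to `n`. -/
theorem stmt_7 (n N : ℕ) (hn : 1 ≤ n) (hN : 2 ≤ N)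
    (H0 : Matrix (Fin n) (Fin n) ℝ) (hH0 : IsHadamardMatrix H0)
    (hreg : ∃ c : ℝ, (∀ i, ∑ j, H0 i j = c) ∧ (∀ j, ∑ i, H0 i j = c))
    (O : Fin (n ^ 2) → Fin N → Fin n)
    (hOA : ∀ c c' : Fin N, c ≠ c' → ∀ pq : Fin n × Fin n,
        ∃! r : Fin (n ^ 2), O r c = pq.1 ∧ O r c' = pq.2) :
    ∃ H : Fin (N - 1) → Matrix (Fin (n ^ 2)) (Fin (n ^ 2)) ℝ,
      (∀ t, IsHadamardMatrix (H t)) ∧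
      (∀ t i, ∑ j, H t i j = n) ∧
      (∀ t j, ∑ i, H t i j = n) ∧
      (∀ t t', t ≠ t' → UnbiasedHadamard (H t) (H t')) := by
  have hn0 : (n : ℝ) ≠ 0 := by positivity
  have : Nonempty (Fin n) := ⟨⟨0, hn⟩⟩
  have : Nontrivial (Fin N) := Fin.nontrivial_iff_two_le.mpr hN
  obtain ⟨c, hr, hc⟩ := hreg
  have hcc : c * c = n := sum_mul_sum_eq_of_mul_transpose_self hH0.2 hr hc
  choose σ hσ using fun s : Fin N => exists_ne s
  have hbij (s : Fin N) : Function.Bijective fun r => (O r s, O r (σ s)) := by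
    rw [Function.bijective_iff_existsUnique]
    intro pq
    simpa [Prod.ext_iff] using hOA s (σ s) (hσ s).symm pq
  let e (s : Fin N) : Fin (n ^ 2) ≃ Fin n × Fin n := Equiv.ofBijective _ (hbij s)
  have he (s s' : Fin N) (h : s ≠ s') (p q : Fin n) :
      ∃! r, (e s r).1 = p ∧ (e s' r).1 = q := hOA s s' h (p, q)
  let z : Fin N := ⟨0, by omega⟩
  let τ (t : Fin (N - 1)) : Fin N := ⟨t + 1, by omega⟩
  have hτz (t : Fin (N - 1)) : τ t ≠ z := by simp [τ, z]
  have hτ (t t' : Fin (N - 1)) (h : t ≠ t') : τ t ≠ τ t' := by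
    simpa [τ, Fin.ext_iff] using h
  refine ⟨fun t => blockCopies H0 (e (τ t)) * (blockCopies H0 (e z))ᵀ,
    fun t => isHadamardMatrix_blockCopies_mul_transpose hn hH0 (he _ _ (hτz t)),
    fun t i => (sum_blockCopies_mul_transpose hr hc _ _ i).trans hcc,
    fun t j => (sum_blockCopies_mul_transpose_left hr hc _ _ j).trans hcc,
    fun t t' htt' => ?_⟩
  have hz := transpose_mul_self_of_mul_transpose_self hn0 (blockCopies_mul_transpose hH0.2 (e z))
  have hsqrt : √((n ^ 2 : ℕ) : ℝ) = n := by
    rw [Nat.cast_pow, Real.sqrt_sq (Nat.cast_nonneg n)]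
  rw [UnbiasedHadamard, hsqrt, Matrix.transpose_mul, Matrix.transpose_transpose, Matrix.mul_assoc,
    ← Matrix.mul_assoc (blockCopies H0 (e z))ᵀ, hz, Matrix.smul_mul, Matrix.one_mul,
    Matrix.mul_smul, smul_smul, inv_mul_cancel₀ hn0, one_smul]
  exact isHadamardMatrix_blockCopies_mul_transpose hn hH0 (he _ _ (hτ t t' htt'))
end

section
/- Let A_0, …, A_d be the adjacency matrices of a symmetric d-class association scheme on a finite set X with |X| = n, and let E_0, …, E_d be its primitive idempotents: real symmetric matrices with E_j·E_k = δ_{jk}·E_j, Σ_j E_j = I, E_0 = (1/n)·J, each lying in the span of the A_i, and write E_j = (1/n)·Σ_i Q_{ij}·A_i (Q is the second eigenmatrix) with m_j = Q_{0j} = rank E_j. Suppose x ∈ ℝ^{d+1} has nonnegative entries and Σ_j Q_{ij}·x_j ∈ {−1, 1} for every i = 1, …, d. Then G = Σ_j x_j·E_j is positive semidefinite of rank Σ_{j : x_j ≠ 0} m_j, every diagonal entry of G equals (Σ_j x_j·m_j)/n, and every off-diagonal entry of G has absolute value 1/n. Consequently the Bose–Mesner algebra contains the Gram matrix of a set of n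 equiangular lines in dimension Σ_{j : x_j ≠ 0} m_j with angle (Σ_j x_j·m_j)^{−1}. -/
open scoped Classical

section Idempotents

variable {ι X : Type*} [Fintype ι] [Fintype X]

/-- The rank of an idempotent real matrix is its trace. -/
theorem Matrix.rank_cast_eq_trace_of_isIdempotentElem {F : Matrix X X ℝ}
    (hF : IsIdempotentElem F) : (F.rank : ℝ) = F.trace := by
  have h : IsIdempotentElem F.toLin' := by
    rw [IsIdempotentElem, Module.End.mul_eq_comp, ← Matrix.toLin'_mul, hF.eq]
  rw [← Matrix.trace_toLin'_eq,
    (LinearMap.IsIdempotentElem.isProj_range _ h).trace, Matrix.rank, Matrix.toLin'_apply']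

/-- Linear combinations of orthogonal idempotents multiply coefficientwise. -/
theorem sum_smul_mul_sum_smul_of_orthogonal [DecidableEq ι] {E : ι → Matrix X X ℝ}
    (hE : ∀ j k, E j * E k = if j = k then E j else 0) (u v : ι → ℝ) :
    (∑ j, u j • E j) * (∑ j, v j • E j) = ∑ j, (u j * v j) • E j := by
  simp [Finset.sum_mul_sum, hE, smul_smul, mul_comm]

/-- The rank of a linear combination of orthogonal idempotents is the sum of the ranks of those
occurring with nonzero coefficient. -/
theorem rank_sum_smul_of_orthogonal [DecidableEq ι] {E : ι → Matrix X X ℝ}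
    (hE : ∀ j k, E j * E k = if j = k then E j else 0) (x : ι → ℝ) :
    (∑ j, x j • E j).rank = ∑ j ∈ Finset.univ.filter (fun j => x j ≠ 0), (E j).rank := by
  set e : ι → ℝ := fun j => if x j = 0 then 0 else 1 with he
  have hmul := sum_smul_mul_sum_smul_of_orthogonal hE
  have hx : (∑ j, x j • E j) * (∑ j, e j • E j) = ∑ j, x j • E j := by
    rw [hmul]
    refine Finset.sum_congr rfl fun j _ => ?_
    by_cases h : x j = 0 <;> simp [he, h]
  have hinv : (∑ j, x j • E j) * (∑ j, (x j)⁻¹ • E j) = ∑ j, e j • E j := by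
    rw [hmul]
    refine Finset.sum_congr rfl fun j _ => ?_
    by_cases h : x j = 0 <;> simp [he, h]
  have hidem : IsIdempotentElem (∑ j, e j • E j) := by
    rw [IsIdempotentElem, hmul]
    refine Finset.sum_congr rfl fun j _ => ?_
    by_cases h : x j = 0 <;> simp [he, h]
  have hrank : (∑ j, x j • E j).rank = (∑ j, e j • E j).rank :=
    le_antisymm (hx ▸ Matrix.rank_mul_le_right _ _) (hinv ▸ Matrix.rank_mul_le_left _ _)
  rw [hrank, ← Nat.cast_inj (R := ℝ), Matrix.rank_cast_eq_trace_of_isIdempotentElem hidem,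
    Matrix.trace_sum, Nat.cast_sum, Finset.sum_filter]
  refine Finset.sum_congr rfl fun j _ => ?_
  have hj : IsIdempotentElem (E j) := by simp [IsIdempotentElem, hE]
  rw [Matrix.rank_cast_eq_trace_of_isIdempotentElem hj]
  by_cases h : x j = 0 <;> simp [he, h]

/-- A nonnegative combination of symmetric idempotents is positive semidefinite. -/
theorem posSemidef_sum_smul_of_idempotent {E : ι → Matrix X X ℝ}
    (hsymm : ∀ j, (E j).IsSymm) (hE : ∀ j, IsIdempotentElem (E j)) {x : ι → ℝ}
    (hx : ∀ j, 0 ≤ x j) : (∑ j, x j • E j).PosSemidef := by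
  refine Matrix.posSemidef_sum _ fun j _ => Matrix.PosSemidef.smul ?_ (hx j)
  have h := Matrix.posSemidef_conjTranspose_mul_self (E j)
  rwa [Matrix.conjTranspose_eq_transpose_of_trivial, (hsymm j).eq, (hE j).eq] at h

end Idempotents

/-- Numbers in `{0, 1}` summing to `1` form the indicator of a single index. -/
theorem eq_single_of_zero_or_one_of_sum_eq_one {ι : Type*} [Fintype ι] [DecidableEq ι]
    {f : ι → ℝ}
    (h01 : ∀ i, f i = 0 ∨ f i = 1) (hsum : ∑ i, f i = 1) {i : ι} (hi : f i = 1) :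
    f = Pi.single i 1 := by
  have hnonneg : ∀ k, 0 ≤ f k := fun k => by rcases h01 k with h | h <;> simp [h]
  have hrest : ∑ k ∈ Finset.univ.erase i, f k = 0 := by
    have := Finset.add_sum_erase Finset.univ f (Finset.mem_univ i)
    linarith
  funext k
  rcases eq_or_ne k i with rfl | hk
  · simp [hi]
  · rw [Pi.single_eq_of_ne hk]
    exact (Finset.sum_eq_zero_iff_of_nonneg fun k _ => hnonneg k).1 hrest k (by simp [hk])

/-- Building equiangular lines inside the Bose–Mesner algebra of a symmetric association
scheme: if `x ≥ 0` and `Σ_j Q_{ij} x_j ∈ {-1,1}` for all `i ≠ 0`, then `G = Σ_j x_j E_j`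
is positive semidefinite of rank `Σ_{x_j ≠ 0} m_j`, with constant diagonal
`(Σ_j x_j m_j)/n` and all off-diagonal entries of absolute value `1/n`. -/
theorem stmt_8 (d n : ℕ) (hn : 0 < n)
    (A E : Fin (d + 1) → Matrix (Fin n) (Fin n) ℝ)
    (p : Fin (d + 1) → Fin (d + 1) → Fin (d + 1) → ℕ)
    (Q : Matrix (Fin (d + 1)) (Fin (d + 1)) ℝ) (m : Fin (d + 1) → ℕ)
    (hA0 : A 0 = 1)
    (hAsum : ∑ i, A i = Matrix.of fun _ _ => (1 : ℝ))
    (hA01 : ∀ i a b, A i a b = 0 ∨ A i a b = 1)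
    (hAsym : ∀ i, (A i).IsSymm)
    (hAmul : ∀ i j, A i * A j = ∑ k, (p i j k : ℝ) • A k)
    (hEsym : ∀ j, (E j).IsSymm)
    (hEorth : ∀ j k, E j * E k = if j = k then E j else 0)
    (hEsum : ∑ j, E j = 1)
    (hE0 : E 0 = (n : ℝ)⁻¹ • Matrix.of fun _ _ => (1 : ℝ))
    (hEQ : ∀ j, E j = (n : ℝ)⁻¹ • ∑ i, Q i j • A i)
    (hrank : ∀ j, (E j).rank = m j)
    (hQ0 : ∀ j, Q 0 j = (m j : ℝ))
    (x : Fin (d + 1) → ℝ) (hx : ∀ j, 0 ≤ x j)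
    (hxQ : ∀ i : Fin (d + 1), i ≠ 0 →
        (∑ j, Q i j * x j = -1 ∨ ∑ j, Q i j * x j = 1)) :
    (∑ j, x j • E j).PosSemidef ∧
    (∑ j, x j • E j).rank = ∑ j ∈ Finset.univ.filter (fun j => x j ≠ 0), m j ∧
    (∀ a, (∑ j, x j • E j) a a = (∑ j, x j * (m j : ℝ)) / n) ∧
    (∀ a b, a ≠ b → |(∑ j, x j • E j) a b| = (n : ℝ)⁻¹) := by
  have hidem : ∀ j, IsIdempotentElem (E j) := fun j => by simp [IsIdempotentElem, hEorth]
  have hsum : ∀ a b, ∑ i, A i a b = 1 := fun a b => by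
    simpa [Matrix.sum_apply] using congrFun (congrFun hAsum a) b
  have hentry : ∀ a b i, A i a b = 1 →
      (∑ j, x j • E j) a b = (n : ℝ)⁻¹ * ∑ j, Q i j * x j := by
    intro a b i hi
    have hsingle := eq_single_of_zero_or_one_of_sum_eq_one (fun k => hA01 k a b) (hsum a b) hi
    have hA : ∀ k, A k a b = if k = i then 1 else 0 := fun k => by
      simpa [Pi.single_apply] using congrFun hsingle k
    have hE : ∀ j, E j a b = (n : ℝ)⁻¹ * Q i j := fun j => by
      rw [hEQ j]
      simp [Matrix.sum_apply, hA]
    simp only [Matrix.sum_apply, Matrix.smul_apply, smul_eq_mul, hE, Finset.mul_sum]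
    exact Finset.sum_congr rfl fun j _ => by ring
  refine ⟨posSemidef_sum_smul_of_idempotent hEsym hidem hx, ?_, fun a => ?_, fun a b hab => ?_⟩
  · simpa only [hrank] using rank_sum_smul_of_orthogonal hEorth x
  · rw [hentry a a 0 (by simp [hA0]), div_eq_inv_mul]
    simp only [hQ0, mul_comm]
  · obtain ⟨i, hi⟩ : ∃ i, A i a b ≠ 0 := by
      by_contra! h
      simpa [h] using hsum a b
    have hi1 : A i a b = 1 := (hA01 i a b).resolve_left hi
    have hi0 : i ≠ 0 := by
      rintro rfl
      exact hi (by simp [hA0, hab])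
    rw [hentry a b i hi1]
    rcases hxQ i hi0 with h | h <;> simp [h]
end

section
/- Let A_0, …, A_d be the adjacency matrices of a symmetric association scheme on a finite set X with |X| = N, and let E be a real symmetric idempotent matrix lying in the span of A_0, …, A_d, with m = trace(E) = rank(E) and m ≥ 2. Then for every integer ℓ ≥ 0, the matrix obtained by applying the Gegenbauer polynomial Q_ℓ^m entrywise to (N/m)·E again lies in the span of A_0, …, A_d and is positive semidefinite; equivalently, writing Q_ℓ^m ∘ ((N/m)E) = Σ_j θ_{ℓj}·E_j in terms of the primitive idempotents E_j, all coefficients θ_{ℓj} are nonnegative. -/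
/-- The Gegenbauer polynomials in dimension `m`:
`Q₀ = 1`, `Q₁(t) = t`, and
`Q_ℓ(t) = ((2ℓ+m-4) t Q_{ℓ-1}(t) - (ℓ-1) Q_{ℓ-2}(t)) / (ℓ+m-3)` for `ℓ ≥ 2`. -/
noncomputable def gegenbauer (m : ℕ) : ℕ → ℝ → ℝ
  | 0, _ => 1
  | 1, t => t
  | (ℓ + 2), t =>
      ((2 * (ℓ : ℝ) + m) * t * gegenbauer m (ℓ + 1) t - ((ℓ : ℝ) + 1) * gegenbauer m ℓ t)
        / ((ℓ : ℝ) + m - 1)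

open MvPolynomial in
/-- The Fischer (apolar) bilinear form on real polynomials, for which monomials are orthogonal
and `X^s` has squared norm `s!`. -/
noncomputable def fischer (σ : Type*) [Fintype σ] :
    MvPolynomial σ ℝ →ₗ[ℝ] MvPolynomial σ ℝ →ₗ[ℝ] ℝ :=
  (basisMonomials σ ℝ).constr ℝ fun s => (∏ i, ((s i).factorial : ℝ)) • lcoeff ℝ s

/-- The derivative of a polynomial in the direction `x`. -/
noncomputable def dirDeriv {σ : Type*} [Fintype σ] (x : σ → ℝ) :
    Derivation ℝ (MvPolynomial σ ℝ) (MvPolynomial σ ℝ) :=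
  ∑ i, x i • MvPolynomial.pderiv i

/-- The Laplacian of a polynomial. -/
noncomputable def polyLaplacian (σ : Type*) [Fintype σ] :
    MvPolynomial σ ℝ →ₗ[ℝ] MvPolynomial σ ℝ :=
  ∑ i, (MvPolynomial.pderiv i).toLinearMap ∘ₗ (MvPolynomial.pderiv i).toLinearMap

/-- The linear form `⟨x, X⟩`. -/
noncomputable def linearForm {σ : Type*} [Fintype σ] (x : σ → ℝ) : MvPolynomial σ ℝ :=
  ∑ i, x i • MvPolynomial.X i

/-- The quadratic form `⟨X, X⟩`. -/
noncomputable def normSqForm (σ : Type*) [Fintype σ] : MvPolynomial σ ℝ :=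
  ∑ i, MvPolynomial.X i * MvPolynomial.X i

/-- The zonal harmonic polynomial with pole `x`, the homogenization of
`gegenbauer (Fintype.card σ) ℓ ⟨x, X⟩`. -/
noncomputable def zonal {σ : Type*} [Fintype σ] (x : σ → ℝ) : ℕ → MvPolynomial σ ℝ
  | 0 => 1
  | 1 => linearForm x
  | (ℓ + 2) => ((ℓ : ℝ) + Fintype.card σ - 1)⁻¹ •
      ((2 * (ℓ : ℝ) + Fintype.card σ) • (linearForm x * zonal x (ℓ + 1))
        - ((ℓ : ℝ) + 1) • (normSqForm σ * zonal x ℓ))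

section Zonal

open MvPolynomial

variable {σ : Type*} [Fintype σ]

lemma dirDeriv_apply (x : σ → ℝ) (f : MvPolynomial σ ℝ) :
    dirDeriv x f = ∑ i, x i • pderiv i f := by
  have h := congrFun (map_sum (Derivation.coeFnAddMonoidHom (R := ℝ) (A := MvPolynomial σ ℝ)
    (M := MvPolynomial σ ℝ)) (fun i => x i • pderiv i) Finset.univ) f
  rw [Finset.sum_apply] at h
  exact h

lemma fischer_monomial (s : σ →₀ ℕ) (a : ℝ) (g : MvPolynomial σ ℝ) :
    fischer σ (monomial s a) g = a * (∏ i, ((s i).factorial : ℝ)) * coeff s g := by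
  have h : monomial s a = a • basisMonomials σ ℝ s := by
    simp [smul_monomial]
  rw [h, map_smul, fischer, Module.Basis.constr_basis]
  simp [mul_assoc]

lemma fischer_self_nonneg (f : MvPolynomial σ ℝ) : 0 ≤ fischer σ f f := by
  have h : fischer σ f f = ∑ s ∈ f.support, fischer σ (monomial s (coeff s f)) f := by
    rw [← LinearMap.sum_apply, ← map_sum, ← f.as_sum]
  rw [h]
  refine Finset.sum_nonneg fun s _ => ?_
  rw [fischer_monomial, mul_right_comm]
  exact mul_nonneg (mul_self_nonneg _) (Finset.prod_nonneg fun i _ => by positivity)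

lemma fischer_X_mul (i : σ) (f g : MvPolynomial σ ℝ) :
    fischer σ (X i * f) g = fischer σ f (pderiv i g) := by
  classical
  induction f using MvPolynomial.induction_on' with
  | add p q hp hq => simp [mul_add, hp, hq]
  | monomial s a =>
    have h : (∏ j, (((s + Finsupp.single i 1 : σ →₀ ℕ) j).factorial : ℝ))
        = (s i + 1) * ∏ j, ((s j).factorial : ℝ) := by
      rw [← Finset.mul_prod_erase _ _ (Finset.mem_univ i),
        ← Finset.mul_prod_erase (a := i) _ (fun j => ((s j).factorial : ℝ)) (Finset.mem_univ i),
        ← mul_assoc]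
      congr 1
      · simp [Nat.factorial_succ]
      · refine Finset.prod_congr rfl fun j hj => ?_
        simp [Finsupp.single_eq_of_ne (Finset.ne_of_mem_erase hj)]
    rw [X, monomial_mul, one_mul, fischer_monomial, fischer_monomial, coeff_pderiv,
      add_comm (Finsupp.single i 1) s, h]
    ring

lemma fischer_linearForm_mul (x : σ → ℝ) (f g : MvPolynomial σ ℝ) :
    fischer σ (linearForm x * f) g = fischer σ f (dirDeriv x g) := by
  simp [linearForm, dirDeriv_apply, Finset.sum_mul, fischer_X_mul]

lemma fischer_normSqForm_mul (f g : MvPolynomial σ ℝ) :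
    fischer σ (normSqForm σ * f) g = fischer σ f (polyLaplacian σ g) := by
  simp [normSqForm, polyLaplacian, Finset.sum_mul, mul_assoc, fischer_X_mul]

lemma isHomogeneous_linearForm (x : σ → ℝ) : (linearForm x).IsHomogeneous 1 :=
  (homogeneousSubmodule σ ℝ 1).sum_mem fun i _ =>
    (homogeneousSubmodule σ ℝ 1).smul_mem _ (isHomogeneous_X ℝ i)

lemma isHomogeneous_normSqForm : (normSqForm σ).IsHomogeneous 2 :=
  IsHomogeneous.sum _ _ _ fun i _ => (isHomogeneous_X ℝ i).mul (isHomogeneous_X ℝ i)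

lemma isHomogeneous_dirDeriv (x : σ → ℝ) {f : MvPolynomial σ ℝ} {n : ℕ}
    (hf : f.IsHomogeneous (n + 1)) : (dirDeriv x f).IsHomogeneous n := by
  rw [dirDeriv_apply]
  exact (homogeneousSubmodule σ ℝ n).sum_mem fun i _ =>
    (homogeneousSubmodule σ ℝ n).smul_mem _ hf.pderiv

/-- Powers of `⟨x, X⟩` reproduce homogeneous polynomials at `x`, up to a factorial. -/
lemma fischer_linearForm_pow (x : σ → ℝ) (n : ℕ) :
    ∀ g : MvPolynomial σ ℝ, g.IsHomogeneous n →
      fischer σ (linearForm x ^ n) g = n.factorial * eval x g := by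
  induction n with
  | zero =>
    intro g hg
    rw [← totalDegree_zero_iff_isHomogeneous, totalDegree_eq_zero_iff_eq_C] at hg
    rw [hg, pow_zero, ← C_1, C_apply, fischer_monomial]
    simp
  | succ n ih =>
    intro g hg
    have euler := congrArg (eval x) hg.sum_X_mul_pderiv
    rw [pow_succ', fischer_linearForm_mul, ih _ (isHomogeneous_dirDeriv x hg)]
    simp only [map_sum, map_mul, eval_X, nsmul_eq_mul, map_natCast] at euler
    have h : eval x (dirDeriv x g) = ∑ i, x i * eval x (pderiv i g) := by
      simp [dirDeriv_apply, smul_eval]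
    rw [h, euler, Nat.factorial_succ]
    push_cast
    ring

lemma pderiv_linearForm (x : σ → ℝ) (i : σ) : pderiv i (linearForm x) = C (x i) := by
  classical
  simp [linearForm, Pi.single_apply, smul_eq_C_mul]

lemma pderiv_normSqForm (i : σ) : pderiv i (normSqForm σ) = 2 * X i := by
  classical
  simp [normSqForm, Pi.single_apply, Finset.sum_add_distrib, two_mul]

lemma dirDeriv_linearForm (x : σ → ℝ) :
    dirDeriv x (linearForm x) = C (∑ i, x i * x i) := by
  simp [dirDeriv_apply, pderiv_linearForm, smul_eq_C_mul]

lemma dirDeriv_normSqForm (x : σ → ℝ) :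
    dirDeriv x (normSqForm σ) = (2 : ℝ) • linearForm x := by
  simp [dirDeriv_apply, pderiv_normSqForm, linearForm, Finset.smul_sum, smul_eq_C_mul,
    mul_left_comm, ← map_ofNat C 2]

lemma polyLaplacian_linearForm_mul (x : σ → ℝ) (f : MvPolynomial σ ℝ) :
    polyLaplacian σ (linearForm x * f)
      = linearForm x * polyLaplacian σ f + (2 : ℝ) • dirDeriv x f := by
  simp only [polyLaplacian, dirDeriv_apply, LinearMap.sum_apply, LinearMap.comp_apply,
    Derivation.coeFn_coe, pderiv_mul, pderiv_linearForm, map_add,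
    pderiv_C, Finset.mul_sum, Finset.smul_sum, ← Finset.sum_add_distrib]
  refine Finset.sum_congr rfl fun i _ => ?_
  simp only [smul_eq_C_mul, map_ofNat]
  ring

lemma polyLaplacian_normSqForm_mul {f : MvPolynomial σ ℝ} {n : ℕ} (hf : f.IsHomogeneous n) :
    polyLaplacian σ (normSqForm σ * f)
      = normSqForm σ * polyLaplacian σ f + (2 * (Fintype.card σ : ℝ) + 4 * n) • f := by
  have euler := hf.sum_X_mul_pderiv
  have h : ∀ i : σ, pderiv i (pderiv i (normSqForm σ * f))
      = normSqForm σ * pderiv i (pderiv i f) + 4 * (X i * pderiv i f) + 2 * f := by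
    intro i
    have h2 : pderiv i (2 : MvPolynomial σ ℝ) = 0 := by
      rw [← map_ofNat C 2]; exact pderiv_C
    simp only [pderiv_mul, pderiv_normSqForm, map_add, h2, pderiv_X_self]
    ring
  simp only [polyLaplacian, LinearMap.sum_apply, LinearMap.comp_apply,
    Derivation.coeFn_coe, h, Finset.sum_add_distrib,
    ← Finset.mul_sum, euler]
  simp only [smul_eq_C_mul, Finset.sum_const, Finset.card_univ, nsmul_eq_mul, map_add, map_mul,
    map_ofNat, map_natCast]
  ring

lemma isHomogeneous_zonal (x : σ → ℝ) : ∀ ℓ, (zonal x ℓ).IsHomogeneous ℓ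
  | 0 => isHomogeneous_one σ ℝ
  | 1 => isHomogeneous_linearForm x
  | (ℓ + 2) => by
    have h1 : (linearForm x * zonal x (ℓ + 1)).IsHomogeneous (ℓ + 2) := by
      have := (isHomogeneous_linearForm x).mul (isHomogeneous_zonal x (ℓ + 1))
      rwa [show 1 + (ℓ + 1) = ℓ + 2 by ring] at this
    have h2 : (normSqForm σ * zonal x ℓ).IsHomogeneous (ℓ + 2) := by
      have := (isHomogeneous_normSqForm (σ := σ)).mul (isHomogeneous_zonal x ℓ)
      rwa [add_comm] at this
    rw [zonal]
    exact (homogeneousSubmodule σ ℝ (ℓ + 2)).smul_mem _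
      ((homogeneousSubmodule σ ℝ (ℓ + 2)).sub_mem
        ((homogeneousSubmodule σ ℝ (ℓ + 2)).smul_mem _ h1)
        ((homogeneousSubmodule σ ℝ (ℓ + 2)).smul_mem _ h2))

lemma zonal_add_two (hσ : 2 ≤ Fintype.card σ) (x : σ → ℝ) (ℓ : ℕ) :
    ((ℓ : ℝ) + Fintype.card σ - 1) • zonal x (ℓ + 2)
      = (2 * (ℓ : ℝ) + Fintype.card σ) • (linearForm x * zonal x (ℓ + 1))
        - ((ℓ : ℝ) + 1) • (normSqForm σ * zonal x ℓ) := by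
  have hc : (2 : ℝ) ≤ Fintype.card σ := by exact_mod_cast hσ
  have hl : (0 : ℝ) ≤ ℓ := ℓ.cast_nonneg
  rw [zonal, smul_inv_smul₀ (by linarith)]

lemma dirDeriv_zonal (hσ : 2 ≤ Fintype.card σ) (x : σ → ℝ) (hx : ∑ i, x i * x i = 1) :
    ∀ ℓ : ℕ, dirDeriv x (zonal x (ℓ + 1)) = ((ℓ : ℝ) + 1) • zonal x ℓ
  | 0 => by simp [zonal, dirDeriv_linearForm, hx]
  | 1 => by
    have hc : (2 : ℝ) ≤ Fintype.card σ := by exact_mod_cast hσ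
    have h := congrArg (dirDeriv x) (zonal_add_two hσ x 0)
    have hne : ((0 : ℕ) : ℝ) + Fintype.card σ - 1 ≠ 0 := by push_cast; linarith
    refine smul_right_injective _ hne ?_
    simp only [Derivation.map_smul, map_sub, Derivation.leibniz, zonal, dirDeriv_linearForm, hx,
      dirDeriv_normSqForm, smul_eq_mul, map_one, Derivation.map_one_eq_zero] at h ⊢
    rw [h]
    simp only [smul_eq_C_mul, map_add, map_sub, map_mul, map_ofNat, map_natCast, map_one]
    push_cast
    ring
  | (ℓ + 2) => by
    have hc : (2 : ℝ) ≤ Fintype.card σ := by exact_mod_cast hσ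
    have hl : (0 : ℝ) ≤ ℓ := ℓ.cast_nonneg
    have h := congrArg (dirDeriv x) (zonal_add_two hσ x (ℓ + 1))
    have hrec := zonal_add_two hσ x ℓ
    have ih1 := dirDeriv_zonal hσ x hx (ℓ + 1)
    have ih0 := dirDeriv_zonal hσ x hx ℓ
    have hne : ((ℓ + 1 : ℕ) : ℝ) + Fintype.card σ - 1 ≠ 0 := by push_cast; linarith
    refine smul_right_injective _ hne ?_
    simp only [Derivation.map_smul, map_sub, Derivation.leibniz, dirDeriv_linearForm, hx,
      dirDeriv_normSqForm, smul_eq_mul, ih1, ih0] at h ⊢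
    rw [h]
    simp only [smul_eq_C_mul, map_add, map_sub, map_mul, map_ofNat, map_natCast, map_one]
      at hrec ⊢
    push_cast at hrec ⊢
    linear_combination (-((ℓ : MvPolynomial σ ℝ) + 2)) * hrec

lemma polyLaplacian_zonal (hσ : 2 ≤ Fintype.card σ) (x : σ → ℝ) (hx : ∑ i, x i * x i = 1) :
    ∀ ℓ : ℕ, polyLaplacian σ (zonal x ℓ) = 0
  | 0 => by simp [zonal, polyLaplacian]
  | 1 => by simp [zonal, polyLaplacian, pderiv_linearForm]
  | (ℓ + 2) => by
    rw [zonal, map_smul, map_sub, map_smul, map_smul, polyLaplacian_linearForm_mul,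
      polyLaplacian_normSqForm_mul (isHomogeneous_zonal x ℓ), dirDeriv_zonal hσ x hx,
      polyLaplacian_zonal hσ x hx (ℓ + 1), polyLaplacian_zonal hσ x hx ℓ]
    simp only [mul_zero, zero_add, smul_smul, ← sub_smul]
    rw [show (2 * (ℓ : ℝ) + Fintype.card σ) * (2 * (ℓ + 1))
      - (ℓ + 1) * (2 * Fintype.card σ + 4 * ℓ) = 0 by ring]
    simp

/-- Modulo `⟨X, X⟩`, a zonal polynomial is a positive multiple of a power of `⟨x, X⟩`. -/
lemma zonal_eq_linearForm_pow_add (hσ : 2 ≤ Fintype.card σ) : ∀ ℓ : ℕ,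
    ∃ c : ℝ, 0 < c ∧ ∀ x : σ → ℝ, ∃ W : MvPolynomial σ ℝ,
      zonal x ℓ = c • linearForm x ^ ℓ + normSqForm σ * W
  | 0 => ⟨1, one_pos, fun x => ⟨0, by simp [zonal]⟩⟩
  | 1 => ⟨1, one_pos, fun x => ⟨0, by simp [zonal]⟩⟩
  | (ℓ + 2) => by
    obtain ⟨c, hc, h⟩ := zonal_eq_linearForm_pow_add hσ (ℓ + 1)
    have hcard : (2 : ℝ) ≤ Fintype.card σ := by exact_mod_cast hσ
    have hl : (0 : ℝ) ≤ ℓ := ℓ.cast_nonneg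
    have h1 : 0 < (ℓ : ℝ) + Fintype.card σ - 1 := by linarith
    have h2 : 0 < 2 * (ℓ : ℝ) + Fintype.card σ := by linarith
    refine ⟨((ℓ : ℝ) + Fintype.card σ - 1)⁻¹ * (2 * (ℓ : ℝ) + Fintype.card σ) * c,
      by positivity, fun x => ?_⟩
    obtain ⟨W, hW⟩ := h x
    refine ⟨((ℓ : ℝ) + Fintype.card σ - 1)⁻¹ • ((2 * (ℓ : ℝ) + Fintype.card σ) •
      (linearForm x * W) - ((ℓ : ℝ) + 1) • zonal x ℓ), ?_⟩
    rw [zonal, hW]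
    simp only [smul_eq_C_mul, map_mul]
    ring

lemma eval_zonal (x y : σ → ℝ) (hy : ∑ i, y i * y i = 1) :
    ∀ ℓ : ℕ, eval y (zonal x ℓ) = gegenbauer (Fintype.card σ) ℓ (∑ i, x i * y i)
  | 0 => by simp [zonal, gegenbauer]
  | 1 => by simp [zonal, gegenbauer, linearForm, smul_eval]
  | (ℓ + 2) => by
    have h1 : eval y (linearForm x) = ∑ i, x i * y i := by simp [linearForm, smul_eval]
    have h2 : eval y (normSqForm σ) = 1 := by simp [normSqForm, hy]
    simp only [zonal, gegenbauer, smul_eval, map_sub, map_mul, h1, h2, eval_zonal x y hy]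
    ring

/-- Schönberg's theorem: a Gegenbauer polynomial in dimension `|σ|`, applied entrywise to the
Gram matrix of unit vectors of `ℝ^σ`, gives a positive semidefinite matrix. -/
theorem gegenbauer_gram_posSemidef {ι : Type*} [Fintype ι] (hσ : 2 ≤ Fintype.card σ)
    (x : ι → σ → ℝ) (hx : ∀ a, ∑ i, x a i * x a i = 1) (ℓ : ℕ) :
    (Matrix.of fun a b => gegenbauer (Fintype.card σ) ℓ (∑ i, x a i * x b i)).PosSemidef := by
  obtain ⟨c, hc, h⟩ := zonal_eq_linearForm_pow_add hσ ℓ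
  have key : ∀ a b, fischer σ (zonal (x a) ℓ) (zonal (x b) ℓ)
      = c * ℓ.factorial * gegenbauer (Fintype.card σ) ℓ (∑ i, x a i * x b i) := by
    intro a b
    obtain ⟨W, hW⟩ := h (x a)
    rw [hW, map_add, LinearMap.add_apply, fischer_normSqForm_mul,
      polyLaplacian_zonal hσ _ (hx b), map_zero, add_zero, map_smul, LinearMap.smul_apply,
      fischer_linearForm_pow _ _ _ (isHomogeneous_zonal _ _), eval_zonal _ _ (hx a),
      smul_eq_mul, mul_assoc]
    simp only [mul_comm]
  have hpos : 0 < c * ℓ.factorial := by positivity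
  refine .of_dotProduct_mulVec_nonneg ?_ fun v => ?_
  · ext a b
    simp [mul_comm]
  · rw [← mul_nonneg_iff_of_pos_left hpos]
    refine (fischer_self_nonneg (∑ a, v a • zonal (x a) ℓ)).trans_eq ?_
    simp only [map_sum, map_smul, LinearMap.sum_apply, LinearMap.smul_apply, smul_eq_mul, key,
      dotProduct, Matrix.mulVec, Matrix.of_apply, Finset.mul_sum, star_trivial]
    rw [Finset.sum_comm]
    refine Finset.sum_congr rfl fun a _ => Finset.sum_congr rfl fun b _ => ?_
    ring_nf

end Zonal

/-- A real symmetric idempotent matrix of rank `m` is the Gram matrix of vectors of `ℝ^m`. -/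
lemma exists_gram_of_symm_idempotent {ι : Type*} [Fintype ι] [DecidableEq ι]
    {E : Matrix ι ι ℝ} (hsym : E.IsSymm) (hidem : E * E = E) {m : ℕ} (hrank : E.rank = m) :
    ∃ x : ι → Fin m → ℝ, ∀ a b, E a b = ∑ i, x a i * x b i := by
  let V := LinearMap.range (Matrix.toLpLin 2 2 E)
  have hV : Module.finrank ℝ V = m := by
    rw [← hrank, Matrix.rank_eq_finrank_range_toLin E (PiLp.basisFun 2 ℝ ι)
      (PiLp.basisFun 2 ℝ ι), ← Matrix.toLpLin_eq_toLin]
  let b := (stdOrthonormalBasis ℝ V).reindex (finCongr hV)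
  let u : ι → V := fun a => ⟨_, LinearMap.mem_range_self _ (EuclideanSpace.single a (1 : ℝ))⟩
  refine ⟨fun a i => inner ℝ (u a) (b i), fun a c => ?_⟩
  have h : ∑ i, inner ℝ (u a) (b i) * inner ℝ (u c) (b i) = inner ℝ (u a) (u c) := by
    simp_rw [← b.sum_inner_mul_inner (u a) (u c), real_inner_comm (u c)]
  rw [h]
  have hent := congrFun (congrFun hidem a) c
  rw [Matrix.mul_apply] at hent
  rw [← hent]
  simp only [u, Submodule.coe_inner, PiLp.inner_apply]
  refine Finset.sum_congr rfl fun k _ => ?_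
  simp [Matrix.toLpLin_apply, mul_comm, hsym.apply a k]

section Scheme

variable {ι κ : Type*} [Fintype ι] {A : ι → Matrix κ κ ℝ}

/-- A linear combination of a partition of `J` into 01-matrices is constant on each part. -/
lemma sum_smul_apply_of_eq_one (hsum : ∑ i, A i = Matrix.of fun _ _ => (1 : ℝ))
    (h01 : ∀ i a b, A i a b = 0 ∨ A i a b = 1) (c : ι → ℝ) (a b : κ) (i : ι)
    (hi : A i a b = 1) : (∑ j, c j • A j) a b = c i := by
  classical
  have hone : ∑ j, A j a b = 1 := by
    have := congrFun (congrFun hsum a) b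
    simpa [Matrix.sum_apply] using this
  have hzero : ∀ j, j ≠ i → A j a b = 0 := by
    intro j hj
    have hnn : ∀ k ∈ Finset.univ.erase i, 0 ≤ A k a b := fun k _ => by
      rcases h01 k a b with h | h <;> simp [h]
    rw [← Finset.add_sum_erase _ _ (Finset.mem_univ i), hi, add_eq_left,
      Finset.sum_eq_zero_iff_of_nonneg hnn] at hone
    exact hone j (by simp [hj])
  rw [Matrix.sum_apply, Finset.sum_eq_single i]
  · simp [hi]
  · intro j _ hj
    simp [hzero j hj]
  · simp

/-- The span of a partition of `J` into 01-matrices is closed under entrywise functions. -/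
lemma of_comp_mem_span (hsum : ∑ i, A i = Matrix.of fun _ _ => (1 : ℝ))
    (h01 : ∀ i a b, A i a b = 0 ∨ A i a b = 1) {M : Matrix κ κ ℝ}
    (hM : M ∈ Submodule.span ℝ (Set.range A)) (f : ℝ → ℝ) :
    (Matrix.of fun a b => f (M a b)) ∈ Submodule.span ℝ (Set.range A) := by
  obtain ⟨c, rfl⟩ := (Submodule.mem_span_range_iff_exists_fun ℝ).1 hM
  refine (Submodule.mem_span_range_iff_exists_fun ℝ).2 ⟨fun i => f (c i), ?_⟩
  ext a b
  obtain ⟨i, hi⟩ : ∃ i, A i a b = 1 := by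
    by_contra! hne
    have := congrFun (congrFun hsum a) b
    simp [Matrix.sum_apply, fun i => (h01 i a b).resolve_right (hne i)] at this
  rw [sum_smul_apply_of_eq_one hsum h01 _ a b i hi, Matrix.of_apply,
    sum_smul_apply_of_eq_one hsum h01 c a b i hi]

end Scheme

/-- Schönberg's theorem applied to an association scheme: if `E` is a symmetric idempotent
of rank (and trace) `m ≥ 2` in the Bose–Mesner algebra of a symmetric association scheme
on `N` points, then every Gegenbauer polynomial `Q_ℓ^m` applied entrywise to `(N/m)·E`
lies again in the Bose–Mesner algebra and is positive semidefinite. -/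
theorem stmt_9 (N d : ℕ) (hN : 0 < N)
    (A : Fin (d + 1) → Matrix (Fin N) (Fin N) ℝ)
    (p : Fin (d + 1) → Fin (d + 1) → Fin (d + 1) → ℕ)
    (hA0 : A 0 = 1)
    (hAsum : ∑ i, A i = Matrix.of fun _ _ => (1 : ℝ))
    (hA01 : ∀ i a b, A i a b = 0 ∨ A i a b = 1)
    (hAsym : ∀ i, (A i).IsSymm)
    (hAmul : ∀ i j, A i * A j = ∑ k, (p i j k : ℝ) • A k)
    (E : Matrix (Fin N) (Fin N) ℝ)
    (hEsym : E.IsSymm) (hEidem : E * E = E)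
    (hEspan : E ∈ Submodule.span ℝ (Set.range A))
    (m : ℕ) (hm : 2 ≤ m) (htrace : E.trace = (m : ℝ)) (hrank : E.rank = m) :
    ∀ ℓ : ℕ,
      (Matrix.of fun a b => gegenbauer m ℓ (((N : ℝ) / m) * E a b)) ∈
          Submodule.span ℝ (Set.range A) ∧
      (Matrix.of fun a b => gegenbauer m ℓ (((N : ℝ) / m) * E a b)).PosSemidef := by
  intro ℓ
  refine ⟨of_comp_mem_span hAsum hA01 hEspan fun t => gegenbauer m ℓ ((N : ℝ) / m * t), ?_⟩
  have hN0 : (N : ℝ) ≠ 0 := by exact_mod_cast hN.ne'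
  have hm0 : (m : ℝ) ≠ 0 := by exact_mod_cast (by omega : m ≠ 0)
  have hdiag : ∀ a, (N : ℝ) / m * E a a = 1 := by
    obtain ⟨c, rfl⟩ := (Submodule.mem_span_range_iff_exists_fun ℝ).1 hEspan
    have hc : ∀ a, (∑ j, c j • A j) a a = c 0 := fun a =>
      sum_smul_apply_of_eq_one hAsum hA01 c a a 0 (by simp [hA0])
    have htr : (N : ℝ) * c 0 = m := by
      rw [← htrace]
      simp [Matrix.trace, hc]
    intro a
    rw [hc, div_mul_eq_mul_div, htr, div_self hm0]
  obtain ⟨x, hx⟩ := exists_gram_of_symm_idempotent hEsym hEidem hrank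
  have hscale : ∀ a b, ∑ i, (√((N : ℝ) / m) * x a i) * (√((N : ℝ) / m) * x b i)
      = (N : ℝ) / m * E a b := by
    intro a b
    rw [hx, Finset.mul_sum]
    refine Finset.sum_congr rfl fun i _ => ?_
    rw [mul_mul_mul_comm, Real.mul_self_sqrt (by positivity)]
  have h := gegenbauer_gram_posSemidef (σ := Fin m) (by simpa using hm)
    (fun a i => √((N : ℝ) / m) * x a i) (fun a => (hscale a a).trans (hdiag a)) ℓ
  simpa only [hscale, Fintype.card_fin] using h
end

section
/- Let m > 2 and N > 0 be real numbers and let (a*_i), (b*_i), (c*_i) for i ≥ 0 be sequences of nonnegative reals. Define real numbers θ_{ℓ,i} for ℓ, i ≥ 0 by: θ_{0,i} = N if i = 0 and 0 otherwise; θ_{1,i} = N/m if i = 1 and 0 otherwise; and for ℓ ≥ 2, θ_{ℓ,i} = ((2ℓ+m−4)·(c*_i·θ_{ℓ−1,i−1} + a*_i·θ_{ℓ−1,i} + b*_i·θ_{ℓ−1,i+1}) − (ℓ−1)·m·θ_{ℓ−2,i}) / (m·(ℓ+m−3)), with the convention θ_{ℓ,−1} = 0. Then θ_{ℓ,i} =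 0 whenever i > ℓ, and for every ℓ ≥ 1 both θ_{ℓ,ℓ} ≥ 0 and θ_{ℓ,ℓ−1} ≥ 0. -/
/-- The three-term Gegenbauer recurrence for the eigenvalue coefficients `θ_{ℓ,i}` of a
cometric scheme with nonnegative Krein array entries `a*, b*, c*`: then `θ_{ℓ,i} = 0`
for `i > ℓ`, and `θ_{ℓ,ℓ} ≥ 0`, `θ_{ℓ,ℓ-1} ≥ 0` for all `ℓ ≥ 1`. -/
theorem stmt_10 (m N : ℝ) (hm : 2 < m) (hN : 0 < N)
    (a b c : ℤ → ℝ)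
    (ha : ∀ i : ℤ, 0 ≤ i → 0 ≤ a i)
    (hb : ∀ i : ℤ, 0 ≤ i → 0 ≤ b i)
    (hc : ∀ i : ℤ, 0 ≤ i → 0 ≤ c i)
    (θ : ℕ → ℤ → ℝ)
    (hθ0 : ∀ i : ℤ, θ 0 i = if i = 0 then N else 0)
    (hθ1 : ∀ i : ℤ, θ 1 i = if i = 1 then N / m else 0)
    (hθneg : ∀ (ℓ : ℕ) (i : ℤ), i < 0 → θ ℓ i = 0)
    (hrec : ∀ ℓ : ℕ, 2 ≤ ℓ → ∀ i : ℤ, 0 ≤ i →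
        θ ℓ i = ((2 * (ℓ : ℝ) + m - 4) *
              (c i * θ (ℓ - 1) (i - 1) + a i * θ (ℓ - 1) i + b i * θ (ℓ - 1) (i + 1)) -
            ((ℓ : ℝ) - 1) * m * θ (ℓ - 2) i) / (m * ((ℓ : ℝ) + m - 3))) :
    (∀ (ℓ : ℕ) (i : ℤ), (ℓ : ℤ) < i → θ ℓ i = 0) ∧
    (∀ ℓ : ℕ, 1 ≤ ℓ → 0 ≤ θ ℓ (ℓ : ℤ) ∧ 0 ≤ θ ℓ ((ℓ : ℤ) - 1)) := by
  have hstep : ∀ (n : ℕ) (i : ℤ), 0 ≤ i →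
      θ (n + 2) i = ((2 * (n : ℝ) + m) *
          (c i * θ (n + 1) (i - 1) + a i * θ (n + 1) i + b i * θ (n + 1) (i + 1)) -
        ((n : ℝ) + 1) * m * θ n i) / (m * ((n : ℝ) + m - 1)) := by
    intro n i hi
    rw [hrec (n + 2) (by omega) i hi, show n + 2 - 1 = n + 1 by omega, Nat.add_sub_cancel]
    push_cast
    congr 1 <;> ring
  have hzero : ∀ (ℓ : ℕ) (i : ℤ), (ℓ : ℤ) < i → θ ℓ i = 0 := by
    intro ℓ
    induction ℓ using Nat.twoStepInduction with
    | zero =>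
      intro i hi
      rw [hθ0, if_neg (by omega)]
    | one =>
      intro i hi
      rw [hθ1, if_neg (by omega)]
    | more n ih ih' =>
      intro i hi
      push_cast at hi ih'
      rw [hstep n i (by omega), ih i (by omega), ih' (i - 1) (by omega), ih' i (by omega),
        ih' (i + 1) (by omega)]
      simp
  refine ⟨hzero, fun ℓ hℓ => ?_⟩
  induction ℓ, hℓ using Nat.le_induction with
  | base =>
    have : 0 ≤ N / m := div_nonneg hN.le (by linarith)
    simpa [hθ1] using this
  | succ k hk ih =>
    obtain ⟨n, rfl⟩ := Nat.exists_eq_add_of_le' hk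
    obtain ⟨hdiag, hsub⟩ := ih
    have hn : (0 : ℝ) ≤ n := n.cast_nonneg
    have hden : 0 ≤ m * ((n : ℝ) + m - 1) := mul_nonneg (by linarith) (by linarith)
    have hnum : 0 ≤ 2 * (n : ℝ) + m := by linarith
    push_cast at hdiag hsub ⊢
    constructor
    · rw [hstep n _ (by omega), hzero n _ (by omega), hzero (n + 1) (n + 1 + 1) (by omega),
        hzero (n + 1) (n + 1 + 1 + 1) (by omega), add_sub_cancel_right]
      have := mul_nonneg (hc (n + 1 + 1) (by omega)) hdiag
      simpa using div_nonneg (mul_nonneg hnum this) hden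
    · rw [add_sub_cancel_right, hstep n _ (by omega), hzero n _ (by omega),
        hzero (n + 1) (n + 1 + 1) (by omega)]
      have := add_nonneg (mul_nonneg (hc (n + 1) (by omega)) hsub)
        (mul_nonneg (ha (n + 1) (by omega)) hdiag)
      rw [mul_zero, mul_zero, add_zero, sub_zero]
      exact div_nonneg (mul_nonneg hnum this) hden
end

section
/- Let Γ be a connected strongly regular graph with parameters (v, k, λ, μ) and let β > 0. Suppose ℓ assigns to each vertex of Γ a unit vector in ℝ^m such that |⟨ℓ(u), ℓ(w)⟩| = β whenever u and w are adjacent and ⟨ℓ(u), ℓ(w)⟩ = 0 whenever u ≠ w are non-adjacent (an orthogonal projective double OPD_m(Γ; β)). Then m·(1 + k·β²) ≥ v, and equality holds if and only if Σ_{u ∈ V(Γ)} ℓ(u)·ℓ(u)ᵀ = (v/m)·I_m, i.e., if and only if m/(2v) times the Gram matrix of the 2v vectors {±ℓ(u)} is an idempotent matrix. -/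
open scoped RealInnerProductSpace

/-- The squared Frobenius distance from the frame operator of a finite family of vectors to a
scalar matrix, in terms of the inner products of the family. -/
theorem sum_sq_frame_sub_smul_one {V : Type*} [Fintype V] {m : ℕ}
    (f : V → EuclideanSpace ℝ (Fin m)) (c : ℝ) :
    ∑ i, ∑ j, ((∑ u, Matrix.vecMulVec (fun i => f u i) (fun i => f u i) -
        c • (1 : Matrix (Fin m) (Fin m) ℝ)) i j) ^ 2 =
      ∑ u, ∑ w, ⟪f u, f w⟫ ^ 2 - 2 * c * ∑ u, ‖f u‖ ^ 2 + c ^ 2 * m := by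
  have hentry : ∀ i j, ((∑ u, Matrix.vecMulVec (fun i => f u i) (fun i => f u i) -
      c • (1 : Matrix (Fin m) (Fin m) ℝ)) i j) ^ 2 =
      (∑ u, f u i * f u j) ^ 2 +
        if i = j then c ^ 2 - 2 * c * ∑ u, f u i * f u j else 0 := by
    intro i j
    rw [Matrix.sub_apply, Matrix.sum_apply, Matrix.smul_apply, Matrix.one_apply]
    simp only [Matrix.vecMulVec_apply, smul_eq_mul]
    split_ifs <;> ring
  have hframe : ∑ i, ∑ j, (∑ u, f u i * f u j) ^ 2 = ∑ u, ∑ w, ⟪f u, f w⟫ ^ 2 := by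
    simp only [PiLp.inner_apply, RCLike.inner_apply, conj_trivial, sq, Finset.sum_mul_sum]
    simp_rw [Finset.sum_comm (s := (Finset.univ : Finset (Fin m))) (t := (Finset.univ : Finset V))]
    refine Finset.sum_congr rfl fun u _ => Finset.sum_congr rfl fun w _ =>
      Finset.sum_congr rfl fun i _ => Finset.sum_congr rfl fun j _ => by ring
  have htrace : ∑ i, ∑ u, f u i * f u i = ∑ u, ‖f u‖ ^ 2 := by
    rw [Finset.sum_comm]
    simp only [EuclideanSpace.real_norm_sq_eq, ← sq]
  simp only [hentry, Finset.sum_add_distrib, hframe, Finset.sum_ite_eq, Finset.mem_univ, if_true,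
    Finset.sum_sub_distrib, ← Finset.mul_sum, htrace]
  simp only [Finset.sum_const, Finset.card_univ, Fintype.card_fin, nsmul_eq_mul]
  ring

/-- The sum of the squared inner products of an orthogonal projective double of a regular graph. -/
theorem sum_sq_inner_of_isRegularOfDegree {V E : Type*} [Fintype V]
    [NormedAddCommGroup E] [InnerProductSpace ℝ E]
    (G : SimpleGraph V) [DecidableRel G.Adj] {k : ℕ} (hreg : G.IsRegularOfDegree k)
    {β : ℝ} (f : V → E) (hunit : ∀ u, ‖f u‖ = 1)
    (hadj : ∀ u w, G.Adj u w → |⟪f u, f w⟫| = β)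
    (hnon : ∀ u w, u ≠ w → ¬G.Adj u w → ⟪f u, f w⟫ = 0) :
    ∑ u, ∑ w, ⟪f u, f w⟫ ^ 2 = Fintype.card V * (1 + k * β ^ 2) := by
  classical
  have hrow : ∀ u, ∑ w, ⟪f u, f w⟫ ^ 2 = 1 + k * β ^ 2 := by
    intro u
    have hsq : ∀ w, ⟪f u, f w⟫ ^ 2 =
        (if u = w then 1 else 0) + if G.Adj u w then β ^ 2 else 0 := by
      intro w
      by_cases huw : u = w
      · subst huw
        simp [hunit]
      · by_cases h : G.Adj u w
        · rw [← sq_abs, hadj u w h]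
          simp [huw, h]
        · simp [huw, h, hnon u w huw h]
    simp only [hsq, Finset.sum_add_distrib, Finset.sum_ite_eq, Finset.mem_univ, if_true]
    rw [← Finset.sum_filter, ← G.neighborFinset_eq_filter, Finset.sum_const,
      G.card_neighborFinset_eq_degree, hreg u, nsmul_eq_mul]
  simp only [hrow, Finset.sum_const, Finset.card_univ, nsmul_eq_mul]

/-- Dimension bound for an orthogonal projective double of a connected strongly regular
graph: if `ℓ` sends vertices to unit vectors of `ℝ^m` with `|⟨ℓ u, ℓ w⟩| = β` on edges and
`⟨ℓ u, ℓ w⟩ = 0` on distinct non-adjacent pairs, then `m(1 + kβ²) ≥ v`, with equality iff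
`Σ_u ℓ(u)ℓ(u)ᵀ = (v/m)·I`. -/
theorem stmt_13 (V : Type) [Fintype V] [DecidableEq V]
    (G : SimpleGraph V) [DecidableRel G.Adj]
    (v k lam mu : ℕ) (hsrg : G.IsSRGWith v k lam mu) (hconn : G.Connected)
    (m : ℕ) (β : ℝ) (hβ : 0 < β)
    (f : V → EuclideanSpace ℝ (Fin m))
    (hunit : ∀ u, ‖f u‖ = 1)
    (hadj : ∀ u w, G.Adj u w → |⟪f u, f w⟫| = β)
    (hnon : ∀ u w, u ≠ w → ¬G.Adj u w → ⟪f u, f w⟫ = 0) :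
    (v : ℝ) ≤ m * (1 + k * β ^ 2) ∧
    ((m : ℝ) * (1 + k * β ^ 2) = v ↔
      ∑ u : V, Matrix.vecMulVec (fun i => f u i) (fun i => f u i) =
        ((v : ℝ) / m) • (1 : Matrix (Fin m) (Fin m) ℝ)) := by
  have hcard : Fintype.card V = v := hsrg.card
  obtain ⟨u₀⟩ := hconn.nonempty
  have hv : 0 < (v : ℝ) := by
    rw [← hcard]
    exact_mod_cast Fintype.card_pos_iff.mpr ⟨u₀⟩
  have hm : 0 < (m : ℝ) := by
    rcases Nat.eq_zero_or_pos m with rfl | h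
    · have := hunit u₀
      rw [Subsingleton.elim (f u₀) 0, norm_zero] at this
      exact absurd this zero_ne_one
    · exact_mod_cast h
  have key := sum_sq_frame_sub_smul_one f ((v : ℝ) / m)
  rw [sum_sq_inner_of_isRegularOfDegree G hsrg.regular f hunit hadj hnon, hcard] at key
  have hgap : (v : ℝ) * (1 + k * β ^ 2) - 2 * (v / m) * ∑ u, ‖f u‖ ^ 2 + (v / m : ℝ) ^ 2 * m =
      v / m * (m * (1 + k * β ^ 2) - v) := by
    simp only [hunit, one_pow, Finset.sum_const, Finset.card_univ, hcard, nsmul_eq_mul, mul_one]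
    field_simp
    ring
  rw [hgap] at key
  have hc : 0 < (v : ℝ) / m := div_pos hv hm
  constructor
  · have hnonneg : 0 ≤ (v : ℝ) / m * (m * (1 + k * β ^ 2) - v) :=
      key ▸ Finset.sum_nonneg fun i _ => Finset.sum_nonneg fun j _ => sq_nonneg _
    exact sub_nonneg.mp (nonneg_of_mul_nonneg_right hnonneg hc)
  · constructor
    · intro h
      rw [h, sub_self, mul_zero] at key
      rw [← sub_eq_zero]
      ext i j
      have hi := (Finset.sum_eq_zero_iff_of_nonneg
        fun i _ => Finset.sum_nonneg fun j _ => sq_nonneg _).mp key i (Finset.mem_univ i)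
      have hij := (Finset.sum_eq_zero_iff_of_nonneg
        fun j _ => sq_nonneg _).mp hi j (Finset.mem_univ j)
      exact (pow_eq_zero_iff two_ne_zero).mp hij
    · intro h
      rw [h, sub_self] at key
      simp only [Matrix.zero_apply, ne_eq, OfNat.ofNat_ne_zero, not_false_eq_true, zero_pow,
        Finset.sum_const_zero] at key
      exact sub_eq_zero.mp ((mul_eq_zero.mp key.symm).resolve_left hc.ne')
end

section
/- Let Γ be a connected strongly regular graph with parameters (v, k, λ, μ) and k ≥ 1, and let s = ((λ−μ) − √((λ−μ)² + 4(k−μ)))/2 be its smallest eigenvalue. Suppose Γ contains a Delsarte coclique C, i.e., an independent set with |C| = m where m·(k − s) = −v·s, and suppose an orthogonal projective double OPD_m(Γ; β) exists for some β > 0 in the same dimension m. Then β = 1/√(−s) (equivalently s·β² = −1); furthermore, either Γ is a complete bipartite graph or 1/β is an integer. -/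
open scoped RealInnerProductSpace

section Helpers

variable {V : Type*} {G : SimpleGraph V}

/-- A finite set of pairwise orthogonal unit vectors of full cardinality satisfies the Parseval
identity. -/
lemma sum_inner_mul_inner_of_orthogonal {m : ℕ} {f : V → EuclideanSpace ℝ (Fin m)} {C : Finset V}
    (hcard : C.card = m) (hunit : ∀ a ∈ C, ‖f a‖ = 1)
    (horth : ∀ a ∈ C, ∀ b ∈ C, a ≠ b → ⟪f a, f b⟫ = 0) (x y : EuclideanSpace ℝ (Fin m)) :
    ∑ c ∈ C, ⟪x, f c⟫ * ⟪f c, y⟫ = ⟪x, y⟫ := by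
  have hon : Orthonormal ℝ (fun c : C => f c) :=
    ⟨fun c => hunit c c.2, fun a b hab => horth a a.2 b b.2 fun h => hab (Subtype.ext h)⟩
  have hspan : ⊤ ≤ Submodule.span ℝ (Set.range fun c : C => f c) :=
    (hon.linearIndependent.span_eq_top_of_card_eq_finrank' (by simp [hcard])).ge
  have hsum := (OrthonormalBasis.mk hon hspan).sum_inner_mul_inner x y
  simp only [OrthonormalBasis.coe_mk] at hsum
  rw [← hsum]
  exact (Finset.sum_coe_sort C fun c => ⟪x, f c⟫ * ⟪f c, y⟫).symm

/-- In a regular graph, the numbers of neighbours in a coclique `C`, summed over the vertices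
outside `C`, add up to `|C| * k`. -/
lemma sum_compl_card_adj_of_coclique [Fintype V] [DecidableEq V] [DecidableRel G.Adj] {k : ℕ}
    (hreg : G.IsRegularOfDegree k) {C : Finset V} (hC : ∀ a ∈ C, ∀ b ∈ C, ¬G.Adj a b) :
    ∑ x ∈ Cᶜ, (C.filter (G.Adj x)).card = C.card * k := by
  have hdeg : ∀ c ∈ C, (Cᶜ.filter fun x => G.Adj x c).card = k := by
    intro c hc
    rw [← hreg c, ← G.card_neighborFinset_eq_degree]
    congr 1
    ext x
    simp only [Finset.mem_filter, Finset.mem_compl, SimpleGraph.mem_neighborFinset]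
    exact ⟨fun h => h.2.symm, fun h => ⟨fun hx => hC c hc x hx h, h.symm⟩⟩
  rw [← smul_eq_mul, ← Finset.sum_const, ← Finset.sum_congr rfl hdeg]
  exact Finset.sum_card_bipartiteAbove_eq_sum_card_bipartiteBelow G.Adj

/-- A connected strongly regular graph with `μ = 0` is complete. -/
lemma SimpleGraph.IsSRGWith.adj_of_connected [Fintype V] [DecidableEq V] [DecidableRel G.Adj]
    {v k lam : ℕ} (hsrg : G.IsSRGWith v k lam 0) (hconn : G.Connected) {u w : V}
    (huw : u ≠ w) : G.Adj u w := by
  obtain ⟨p⟩ := hconn u w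
  induction p with
  | nil => exact absurd rfl huw
  | @cons a b c hab _ ih =>
    by_contra hac
    rcases eq_or_ne b c with rfl | hbc
    · exact hac hab
    · have hcard := hsrg.of_not_adj huw hac
      rw [Fintype.card_eq_zero_iff] at hcard
      exact hcard.false ⟨b, hab, (ih hbc).symm⟩

/-- A connected strongly regular graph with bipartition `C`, `Cᶜ` is complete bipartite. -/
lemma SimpleGraph.IsSRGWith.adj_of_bipartition [Fintype V] [DecidableEq V] [DecidableRel G.Adj]
    {v k lam mu : ℕ} (hsrg : G.IsSRGWith v k lam mu) (hconn : G.Connected) {C : Finset V}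
    (hC : ∀ a ∈ C, ∀ b ∈ C, ¬G.Adj a b) (hC' : ∀ a ∉ C, ∀ b ∉ C, ¬G.Adj a b)
    {u w : V} (hu : u ∈ C) (hw : w ∉ C) : G.Adj u w := by
  by_contra huw
  have hne : u ≠ w := fun h => hw (h ▸ hu)
  have hcard := hsrg.of_not_adj hne huw
  obtain rfl : mu = 0 := by
    rw [← hcard, Fintype.card_eq_zero_iff]
    refine ⟨fun ⟨x, hux, hwx⟩ => ?_⟩
    by_cases hx : x ∈ C
    · exact hC u hu x hx hux
    · exact hC' w hw x hx hwx
  exact huw (hsrg.adj_of_connected hconn hne)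

end Helpers

/-- If a connected strongly regular graph with smallest eigenvalue `s` contains a Delsarte
coclique of size `m` and admits an orthogonal projective double `OPD_m(Γ;β)` in the same
dimension `m`, then `β = 1/√(-s)` (equivalently `s β² = -1`), and moreover either the
graph is complete bipartite or `1/β` is an integer. -/
theorem stmt_14 (V : Type) [Fintype V] [DecidableEq V]
    (G : SimpleGraph V) [DecidableRel G.Adj]
    (v k lam mu : ℕ) (hsrg : G.IsSRGWith v k lam mu) (hconn : G.Connected) (hk : 1 ≤ k)
    (s : ℝ)
    (hs : s = (((lam : ℝ) - mu) -
        Real.sqrt (((lam : ℝ) - mu) ^ 2 + 4 * ((k : ℝ) - mu))) / 2)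
    (m : ℕ) (C : Finset V)
    (hCind : ∀ a ∈ C, ∀ b ∈ C, ¬G.Adj a b)
    (hCcard : C.card = m)
    (hDelsarte : (m : ℝ) * ((k : ℝ) - s) = -(v : ℝ) * s)
    (β : ℝ) (hβ : 0 < β)
    (f : V → EuclideanSpace ℝ (Fin m))
    (hunit : ∀ u, ‖f u‖ = 1)
    (hadj : ∀ u w, G.Adj u w → |⟪f u, f w⟫| = β)
    (hnon : ∀ u w, u ≠ w → ¬G.Adj u w → ⟪f u, f w⟫ = 0) :
    β = (Real.sqrt (-s))⁻¹ ∧ s * β ^ 2 = -1 ∧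
      ((∃ P : Set V, ∀ u w, G.Adj u w ↔ ((u ∈ P ∧ w ∉ P) ∨ (u ∉ P ∧ w ∈ P))) ∨
        ∃ z : ℤ, β⁻¹ = (z : ℝ)) := by
  have hpars : ∀ x y, ∑ c ∈ C, ⟪f x, f c⟫ * ⟪f c, f y⟫ = ⟪f x, f y⟫ := fun x y =>
    sum_inner_mul_inner_of_orthogonal hCcard (fun a _ => hunit a)
      (fun a ha b hb hab => hnon a b hab (hCind a ha b hb)) (f x) (f y)
  have hout : ∀ x ∈ Cᶜ, β ^ 2 * ((C.filter (G.Adj x)).card : ℝ) = 1 := by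
    intro x hx
    have hterm : ∀ c ∈ C, ⟪f x, f c⟫ * ⟪f c, f x⟫ = if G.Adj x c then β ^ 2 else 0 := by
      intro c hc
      rw [real_inner_comm (f x) (f c), ← sq]
      split_ifs with h
      · rw [← hadj x c h, sq_abs]
      · rw [hnon x c (fun h' => Finset.mem_compl.1 hx (h' ▸ hc)) h]
        simp
    have hxx := hpars x x
    rw [Finset.sum_congr rfl hterm, real_inner_self_eq_norm_sq, hunit, ← Finset.sum_filter,
      Finset.sum_const, nsmul_eq_mul] at hxx
    linarith
  have hcount : β ^ 2 * ((m : ℝ) * k) = v - m := by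
    have h := sum_compl_card_adj_of_coclique hsrg.regular hCind
    rw [hCcard] at h
    rw [← Nat.cast_mul, ← h, Nat.cast_sum, Finset.mul_sum, Finset.sum_congr rfl hout,
      Finset.sum_const, nsmul_eq_mul, mul_one, Finset.card_compl, hCcard, hsrg.card,
      Nat.cast_sub]
    rw [← hCcard, ← hsrg.card]
    exact Finset.card_le_univ C
  have hm : 0 < m := by
    obtain ⟨x⟩ := hconn.nonempty
    rcases Nat.eq_zero_or_pos m with rfl | h
    · have := hunit x
      rw [Subsingleton.elim (f x) 0] at this
      simp at this
    · exact h
  have hvm : 0 < (v : ℝ) - m := by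
    rw [← hcount]
    positivity
  have hsβ : s * β ^ 2 = -1 := by
    have : ((v : ℝ) - m) * (s * β ^ 2 + 1) = 0 := by
      linear_combination β ^ 2 * hDelsarte - hcount
    rcases mul_eq_zero.1 this with h | h
    · exact absurd h hvm.ne'
    · linarith
  refine ⟨?_, hsβ, ?_⟩
  · have : -s = (β⁻¹) ^ 2 := by
      field_simp
      linarith
    rw [this, Real.sqrt_sq (by positivity), inv_inv]
  by_cases hC' : ∀ a ∉ C, ∀ b ∉ C, ¬G.Adj a b
  · refine Or.inl ⟨C, fun u w => ?_⟩
    simp only [Finset.mem_coe]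
    have huw := fun hu hw => hsrg.adj_of_bipartition (u := u) (w := w) hconn hCind hC' hu hw
    have hwu := fun hw hu => hsrg.adj_of_bipartition (u := w) (w := u) hconn hCind hC' hw hu
    have := hCind u
    have := hC' u
    constructor
    · grind
    · rintro (⟨hu, hw⟩ | ⟨hu, hw⟩)
      · exact huw hu hw
      · exact (hwu hw hu).symm
  · push Not at hC'
    obtain ⟨a, ha, b, hb, hab⟩ := hC'
    right
    have hval : ∀ x ∉ C, ∀ c ∈ C, ∃ z : ℤ, ⟪f x, f c⟫ = β * z := by
      intro x hx c hc
      by_cases h : G.Adj x c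
      · rcases eq_or_eq_neg_of_abs_eq (hadj x c h) with h' | h'
        · exact ⟨1, by simp [h']⟩
        · exact ⟨-1, by simp [h']⟩
      · exact ⟨0, by simp [hnon x c (fun h' => hx (h' ▸ hc)) h]⟩
    choose! z hz using hval
    have hinner : ⟪f a, f b⟫ = β ^ 2 * ((∑ c ∈ C, z a c * z b c : ℤ) : ℝ) := by
      rw [← hpars, Int.cast_sum, Finset.mul_sum]
      refine Finset.sum_congr rfl fun c hc => ?_
      rw [real_inner_comm (f b) (f c), hz a ha c hc, hz b hb c hc]
      push_cast
      ring
    refine ⟨|∑ c ∈ C, z a c * z b c|, ?_⟩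
    have h := hadj a b hab
    rw [hinner, abs_mul, abs_of_pos (by positivity : 0 < β ^ 2), ← Int.cast_abs] at h
    field_simp
    nlinarith
end
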